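/- arXiv:2203.12070 — 4 statements merged into one kernel-verified Lean document; each statement's English description precedes it below -/
import Mathlib

section
/- Let V and K be complex Hilbert spaces, 𝔞 : V × V → ℂ a continuous symmetric sesquilinear form, and j : V → K a continuous linear map. Suppose either (a) 𝔞 is j-elliptic, or (b) there exists a Hilbert space H and a compact linear map i : V → H such that 𝔞 is i-elliptic. Then the graph A associated with (𝔞, j), namely {(j(u), f) ∈ K × K : u ∈ V and 𝔞(u,v) = (f, j(v))_K for all v ∈ V}, is a lower-bounded self-adjoint graph in K × K. Moreover, if j is compact, then A has compact resolvent and in particular discrete spectrum. -/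
/-!
Abstract framework for forms, graphs (linear relations) and their spectra,
following Arendt--ter Elst style form methods.
-/

noncomputable section
open Complex Filter Topology ComplexConjugate

local notation "⟪" x ", " y "⟫" => @inner ℂ _ _ x y

section Defs

variable {V K H W : Type*}
variable [NormedAddCommGroup V] [InnerProductSpace ℂ V]
variable [NormedAddCommGroup K] [InnerProductSpace ℂ K]
variable [NormedAddCommGroup H] [InnerProductSpace ℂ H]

/-- The form `a` is sesquilinear: linear in the first argument and conjugate-linear in the
second argument. -/
def IsSesqui (a : V → V → ℂ) : Prop :=
  (∀ u₁ u₂ v, a (u₁ + u₂) v = a u₁ v + a u₂ v) ∧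
  (∀ u v₁ v₂, a u (v₁ + v₂) = a u v₁ + a u v₂) ∧
  (∀ (c : ℂ) u v, a (c • u) v = c * a u v) ∧
  (∀ (c : ℂ) u v, a u (c • v) = conj c * a u v)

/-- The form `a` is continuous (bounded): `|a u v| ≤ M ‖u‖ ‖v‖`. -/
def IsContinuousForm (a : V → V → ℂ) : Prop :=
  ∃ M : ℝ, 0 < M ∧ ∀ u v, ‖a u v‖ ≤ M * ‖u‖ * ‖v‖

/-- The form `a` is symmetric: `a v u = conj (a u v)`. -/
def IsSymmForm (a : V → V → ℂ) : Prop := ∀ u v, a v u = conj (a u v)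

/-- The form `a` is positive: `a u u ≥ 0` (in particular real) for all `u`. -/
def IsPositiveForm (a : V → V → ℂ) : Prop := ∀ u, 0 ≤ (a u u).re ∧ (a u u).im = 0

/-- The form `a` is `j`-elliptic: `Re (a u u) + ω ‖j u‖² ≥ μ ‖u‖²` with `ω, μ > 0`. -/
def IsElliptic [NormedAddCommGroup W] (a : V → V → ℂ) (j : V → W) : Prop :=
  ∃ ω μ : ℝ, 0 < ω ∧ 0 < μ ∧ ∀ u, μ * ‖u‖ ^ 2 ≤ (a u u).re + ω * ‖j u‖ ^ 2

/-- The graph associated with `(a, j)`: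
`{(j u, f) : u ∈ V, a u v = (f, j v)_K for all v ∈ V}`.  Here `(f, g)_K` denotes the inner
product which is linear in `f`, i.e. `(f, g)_K = ⟪g, f⟫` in Mathlib's convention. -/
def GraphOf (a : V → V → ℂ) (j : V →L[ℂ] K) : Set (K × K) :=
  {p | ∃ u : V, p.1 = j u ∧ ∀ v : V, a u v = ⟪j v, p.2⟫}

/-- The graph associated with `(a|_{W×W}, j|_W)` for a subspace (set) `W ⊆ V`. -/
def GraphOfOn (a : V → V → ℂ) (j : V →L[ℂ] K) (W : Set V) : Set (K × K) :=
  {p | ∃ u ∈ W, p.1 = j u ∧ ∀ v ∈ W, a u v = ⟪j v, p.2⟫}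

/-- The (graph of the) self-adjoint *operator* associated with the form `a|_{W×W}` in the
closure of `i(W)` in `H`:  `u ∈ D(A)` and `A u = f` iff `u ∈ W`, `f ∈ closure (i '' W)` and
`a u v = (f, v)_H` for all `v ∈ W`. -/
def OpGraphOf (a : V → V → ℂ) (i : V →L[ℂ] H) (W : Set V) : Set (H × H) :=
  {p | ∃ u ∈ W, p.1 = i u ∧ p.2 ∈ closure (i '' W) ∧ ∀ v ∈ W, a u v = ⟪i v, p.2⟫}

/-- The adjoint of a graph (linear relation) `A ⊆ K × K`. -/
def AdjointGraph (A : Set (K × K)) : Set (K × K) :=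
  {q | ∀ p ∈ A, ⟪q.1, p.2⟫ = ⟪q.2, p.1⟫}

/-- A graph is self-adjoint if it coincides with its adjoint. -/
def IsSelfAdjointGraph (A : Set (K × K)) : Prop := AdjointGraph A = A

/-- A graph is lower bounded if `(f, x)_K ≥ c ‖x‖²` for all `(x, f)` in the graph. -/
def IsLowerBoundedGraph (A : Set (K × K)) : Prop :=
  ∃ c : ℝ, ∀ p ∈ A, c * ‖p.1‖ ^ 2 ≤ (⟪p.1, p.2⟫).re

/-- A graph has compact resolvent: `(λ I + A)⁻¹` is a compact (everywhere defined, bounded)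
operator for all large real `λ`. -/
def HasCompactResolventGraph (A : Set (K × K)) : Prop :=
  ∃ lam₀ : ℝ, ∀ lam : ℝ, lam₀ ≤ lam → ∃ R : K →L[ℂ] K, IsCompactOperator ⇑R ∧
    (∀ p ∈ A, R ((lam : ℂ) • p.1 + p.2) = p.1) ∧
    (∀ y : K, ∃ p ∈ A, (lam : ℂ) • p.1 + p.2 = y)

/-- The resolvent set of a graph: those `z` for which `(A - z)⁻¹` is an everywhere defined
bounded operator. -/
def GraphResolventSet (A : Set (K × K)) : Set ℂ :=
  {z | ∃ R : K →L[ℂ] K, (∀ p ∈ A, R (p.2 - z • p.1) = p.1) ∧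
        ∀ y : K, ∃ p ∈ A, p.2 - z • p.1 = y}

/-- The spectrum of a graph. -/
def GraphSpectrum (A : Set (K × K)) : Set ℂ := (GraphResolventSet A)ᶜ

/-- `t` is an eigenvalue of the graph `A`. -/
def IsEigenvalueG (A : Set (K × K)) (t : ℂ) : Prop := ∃ x : K, x ≠ 0 ∧ (x, t • x) ∈ A

/-- The spectrum of the graph is discrete: it consists of isolated eigenvalues. -/
def HasDiscreteSpectrumGraph (A : Set (K × K)) : Prop :=
  ∀ z ∈ GraphSpectrum A, IsEigenvalueG A z ∧
    ∃ ε : ℝ, 0 < ε ∧ ∀ w ∈ GraphSpectrum A, w ≠ z → ε ≤ ‖w - z‖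

/-- The multiplicity of `t` as an eigenvalue of the graph `A`: the dimension of the eigenspace
`{x : (x, t x) ∈ A}` (for a graph this set is a subspace of `K`, hence equals its span). -/
def eigMult (A : Set (K × K)) (t : ℝ) : ℕ :=
  Module.finrank ℂ ↥(Submodule.span ℂ {x : K | (x, (t : ℂ) • x) ∈ A})

/-- `lam` is the sequence of eigenvalues of the graph `A`, listed in increasing order and
repeated with multiplicity. -/
def IsEigSeq (A : Set (K × K)) (lam : ℕ → ℝ) : Prop :=
  Monotone lam ∧ (∀ t : ℝ, {n : ℕ | lam n = t}.Finite) ∧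
    ∀ t : ℝ, Nat.card {n : ℕ | lam n = t} = eigMult A t

/-- The multivalued part of a graph. -/
def mulPartG (A : Set (K × K)) : Set K := {f | ((0 : K), f) ∈ A}

/-- The single-valued part of a graph: the pairs whose second component is orthogonal to the
multivalued part. -/
def SingleValuedPartG (A : Set (K × K)) : Set (K × K) :=
  {p | p ∈ A ∧ ∀ m ∈ mulPartG A, ⟪m, p.2⟫ = 0}

/-- The span of `{φ ∈ D(N) : (N° φ, φ)_K = 0}` is infinite dimensional, where `N°` is the
single-valued part of the graph `N`. -/
def InfiniteNullSpan (N : Set (K × K)) : Prop :=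
  ¬ Module.Finite ℂ
      ↥(Submodule.span ℂ {φ : K | ∃ f : K, (φ, f) ∈ SingleValuedPartG N ∧ ⟪φ, f⟫ = 0})

/-- `R` is the resolvent `(I + A)⁻¹` of the graph `A`. -/
def IsResolventAtOne (A : Set (K × K)) (R : K →L[ℂ] K) : Prop :=
  (∀ p ∈ A, R (p.1 + p.2) = p.1) ∧ ∀ y : K, ∃ p ∈ A, p.1 + p.2 = y

end Defs

section Helpers

lemma aux_ultra_compact {V H : Type*} [NormedAddCommGroup V] [InnerProductSpace ℂ V]
    [NormedAddCommGroup H] [InnerProductSpace ℂ H] (i : V →L[ℂ] H) (hi : IsCompactOperator ⇑i)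
    (F : Ultrafilter ℕ) (u : ℕ → V) (r : ℝ) (hu : ∀ n, ‖u n‖ ≤ r) :
    ∃ y, Tendsto (fun n => i (u n)) F (𝓝 y) := by
  obtain ⟨Q, hQ, hsub⟩ := IsCompactOperator.image_closedBall_subset_compact
    (f := (i : V →ₗ[ℂ] H)) hi r
  have h := hQ.ultrafilter_le_nhds (F.map fun n => i (u n)) (by
    rw [le_principal_iff]
    refine Filter.mem_map.2 (Filter.univ_mem' fun n => ?_)
    exact hsub ⟨u n, by simpa using hu n, rfl⟩)
  obtain ⟨y, -, hy⟩ := h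
  exact ⟨y, hy⟩

lemma aux_ultra_weak {V : Type*} [NormedAddCommGroup V] [InnerProductSpace ℂ V] [CompleteSpace V]
    (F : Ultrafilter ℕ) (u : ℕ → V) (r : ℝ) (hu : ∀ n, ‖u n‖ ≤ r) :
    ∃ x : V, ∀ v, Tendsto (fun n => ⟪u n, v⟫) F (𝓝 ⟪x, v⟫) := by
  have hc := WeakDual.isCompact_closedBall (𝕜 := ℂ) (E := V) 0 r
  obtain ⟨g, -, hg⟩ := hc.ultrafilter_le_nhds
    (F.map fun n => StrongDual.toWeakDual (InnerProductSpace.toDual ℂ V (u n))) (by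
    rw [le_principal_iff]
    refine Filter.mem_map.2 (Filter.univ_mem' fun n => ?_)
    simpa using hu n)
  refine ⟨(InnerProductSpace.toDual ℂ V).symm (WeakDual.toStrongDual g), fun v => ?_⟩
  have h2 : Tendsto (fun n => StrongDual.toWeakDual (InnerProductSpace.toDual ℂ V (u n))) F (𝓝 g) :=
    hg
  have h3 := ((WeakDual.eval_continuous v).tendsto g).comp h2
  simp only [InnerProductSpace.toDual_symm_apply]
  exact h3

lemma aux_exists_op {V : Type*} [NormedAddCommGroup V] [InnerProductSpace ℂ V] [CompleteSpace V]
    (a : V → V → ℂ) (hs : IsSesqui a) (hc : IsContinuousForm a) :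
    ∃ T : V →L[ℂ] V, ∀ u v, a u v = ⟪v, T u⟫ := by
  obtain ⟨h1, h2, h3, h4⟩ := hs
  obtain ⟨M, hM, hb⟩ := hc
  let f : V →ₗ⋆[ℂ] V →ₗ[ℂ] ℂ := LinearMap.mk₂'ₛₗ (starRingEnd ℂ) (RingHom.id ℂ) (fun v u => a u v)
    (fun _ _ _ => h2 _ _ _) (fun c _ _ => h4 c _ _) (fun _ _ _ => h1 _ _ _) (fun c _ _ => h3 c _ _)
  let B : V →L⋆[ℂ] V →L[ℂ] ℂ := f.mkContinuous₂ M (fun x y => by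
    have := hb y x
    show ‖a y x‖ ≤ _
    linarith)
  refine ⟨ContinuousLinearMap.adjoint (InnerProductSpace.continuousLinearMapOfBilin B),
    fun u v => ?_⟩
  rw [ContinuousLinearMap.adjoint_inner_right,
    InnerProductSpace.continuousLinearMapOfBilin_apply]
  rfl

lemma aux_bddBelow {V : Type*} [NormedAddCommGroup V] [InnerProductSpace ℂ V] [CompleteSpace V]
    (S C : V →L[ℂ] V) (hC : IsCompactOperator ⇑C) (m : ℝ) (hm : 0 < m)
    (hcoer : ∀ u, m * ‖u‖ ^ 2 ≤ (⟪u, S u⟫).re + (⟪u, C u⟫).re) :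
    ∃ c : ℝ, 0 < c ∧ ∀ u ∈ (LinearMap.ker (S : V →ₗ[ℂ] V))ᗮ, c * ‖u‖ ≤ ‖S u‖ := by
  by_contra! hcon
  have key : ∀ u, m * ‖u‖ ≤ ‖S u + C u‖ := by
    intro u
    rcases (norm_nonneg u).eq_or_lt with h | h
    · rw [← h]; simp
    · have h1 := hcoer u
      have h2 : (⟪u, S u⟫).re + (⟪u, C u⟫).re ≤ ‖u‖ * ‖S u + C u‖ := by
        rw [← Complex.add_re, ← inner_add_right]
        exact re_inner_le_norm (𝕜 := ℂ) _ _
      nlinarith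
  have hex : ∀ n : ℕ, ∃ u ∈ (LinearMap.ker (S : V →ₗ[ℂ] V))ᗮ,
      ‖u‖ = 1 ∧ ‖S u‖ ≤ 1 / ((n : ℝ) + 1) := by
    intro n
    obtain ⟨u, hu, hlt⟩ := hcon (1 / ((n : ℝ) + 1)) (by positivity)
    have hu0 : 0 < ‖u‖ := by
      rw [norm_pos_iff]; rintro rfl; simp at hlt
    refine ⟨((‖u‖⁻¹ : ℝ) : ℂ) • u, Submodule.smul_mem _ _ hu, ?_, ?_⟩
    · rw [norm_smul]; simp [hu0.ne']
    · rw [map_smul, norm_smul]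
      simp only [norm_real, norm_inv, norm_norm]
      rw [inv_mul_le_iff₀ hu0]; linarith
  choose u hu hn hS using hex
  let F : Ultrafilter ℕ := hyperfilter ℕ
  have hF : (F : Filter ℕ) ≤ atTop := Nat.hyperfilter_le_atTop
  obtain ⟨y, hy⟩ := aux_ultra_compact C hC F u 1 (fun n => (hn n).le)
  have hS0 : Tendsto (fun n => S (u n)) F (𝓝 0) := by
    apply squeeze_zero_norm hS
    exact tendsto_one_div_add_atTop_nhds_zero_nat.mono_left hF
  have hsum : Tendsto (fun n => (S + C) (u n)) F (𝓝 y) := by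
    simpa using hS0.add hy
  have hanti : AntilipschitzWith (Real.toNNReal m⁻¹) (S + C) := by
    refine ContinuousLinearMap.antilipschitz_of_bound _ fun x => ?_
    rw [Real.coe_toNNReal _ (by positivity)]
    have := key x
    rw [le_inv_mul_iff₀ hm]
    simpa using this
  have hcl := hanti.isClosedEmbedding (S + C).uniformContinuous
  obtain ⟨x, hx⟩ := hcl.isClosed_range.mem_of_tendsto hsum (Filter.univ_mem' fun n => ⟨u n, rfl⟩)
  have hux : Tendsto u F (𝓝 x) := by
    rw [hcl.isInducing.tendsto_nhds_iff, hx]; exact hsum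
  have hSx : S x = 0 := tendsto_nhds_unique ((S.continuous.tendsto x).comp hux) hS0
  have hxp : x ∈ (LinearMap.ker (S : V →ₗ[ℂ] V))ᗮ :=
    (Submodule.isClosed_orthogonal _).mem_of_tendsto hux (Filter.univ_mem' hu)
  have hx1 : ‖x‖ = 1 := by
    have h1 := hux.norm
    simp only [hn] at h1
    exact (tendsto_nhds_unique h1 tendsto_const_nhds)
  have : ⟪x, x⟫ = 0 := hxp x (by simpa using hSx)
  rw [inner_self_eq_zero] at this
  rw [this] at hx1; simp at hx1

lemma aux_range {V : Type*} [NormedAddCommGroup V] [InnerProductSpace ℂ V] [CompleteSpace V]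
    (S C : V →L[ℂ] V) (hC : IsCompactOperator ⇑C) (m : ℝ) (hm : 0 < m)
    (hsym : ∀ u v, ⟪u, S v⟫ = ⟪S u, v⟫)
    (hcoer : ∀ u, m * ‖u‖ ^ 2 ≤ (⟪u, S u⟫).re + (⟪u, C u⟫).re) :
    ∃ k : ℝ, 0 ≤ k ∧ ∀ b, (∀ w, S w = 0 → ⟪w, b⟫ = 0) → ∃ u, S u = b ∧ ‖u‖ ≤ k * ‖b‖ := by
  obtain ⟨c, hc, hbd⟩ := aux_bddBelow S C hC m hm hcoer
  refine ⟨c⁻¹, by positivity, fun b hb => ?_⟩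
  let N := LinearMap.ker (S : V →ₗ[ℂ] V)
  have hNc : IsClosed (N : Set V) := S.isClosed_ker
  have : CompleteSpace N := hNc.completeSpace_coe
  let S' : Nᗮ →L[ℂ] V := S.comp Nᗮ.subtypeL
  have hanti : AntilipschitzWith (Real.toNNReal c⁻¹) S' := by
    refine ContinuousLinearMap.antilipschitz_of_bound _ fun x => ?_
    rw [Real.coe_toNNReal _ (by positivity), le_inv_mul_iff₀ hc]
    exact hbd x x.2
  have hcl := hanti.isClosed_range S'.uniformContinuous
  let R := LinearMap.range (S' : Nᗮ →ₗ[ℂ] V)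
  have hRc : IsClosed (R : Set V) := by
    have : (R : Set V) = Set.range S' := by ext; simp [R]
    rw [this]; exact hcl
  have : CompleteSpace R := hRc.completeSpace_coe
  have hbR : b ∈ R := by
    rw [← R.orthogonal_orthogonal]
    intro w hw
    apply hb
    have h1 : ∀ v, ⟪S v, w⟫ = 0 := by
      intro v
      apply hw
      have hv := Submodule.sub_starProjection_mem_orthogonal (K := N) v
      refine ⟨⟨v - N.starProjection v, hv⟩, ?_⟩
      have : S (N.starProjection v) = 0 := by
        have := Submodule.starProjection_apply_mem N v
        exact LinearMap.mem_ker.1 this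
      simp [S', this]
    have := h1 (S w)
    rw [← hsym, inner_self_eq_zero] at this
    exact this
  obtain ⟨u, hu⟩ := hbR
  refine ⟨u, hu, ?_⟩
  rw [le_inv_mul_iff₀ hc, ← hu]
  exact hbd u u.2

lemma aux_lower {V K H : Type*} [NormedAddCommGroup V] [InnerProductSpace ℂ V] [CompleteSpace V]
    [NormedAddCommGroup K] [InnerProductSpace ℂ K]
    [NormedAddCommGroup H] [InnerProductSpace ℂ H]
    (T : V →L[ℂ] V) (hsym : ∀ u v, ⟪u, T v⟫ = ⟪T u, v⟫) (j : V →L[ℂ] K) (i : V →L[ℂ] H)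
    (hi : IsCompactOperator ⇑i) (w m : ℝ) (hw : 0 < w) (hm : 0 < m)
    (hell : ∀ u, m * ‖u‖ ^ 2 ≤ (⟪u, T u⟫).re + w * ‖i u‖ ^ 2) :
    ∃ c : ℝ, ∀ u f, (∀ v, ⟪v, T u⟫ = ⟪j v, f⟫) → c * ‖j u‖ ^ 2 ≤ (⟪u, T u⟫).re := by
  by_contra! hcon
  let Kj := LinearMap.ker (j : V →ₗ[ℂ] K)
  let W : Submodule ℂ V := Kjᗮ.comap (T : V →ₗ[ℂ] V)
  have hWc : IsClosed (W : Set V) := (Submodule.isClosed_orthogonal Kj).preimage T.continuous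
  let N := Kj ⊓ W
  have hNc : IsClosed (N : Set V) := j.isClosed_ker.inter hWc
  have : CompleteSpace N := hNc.completeSpace_coe
  have hex : ∀ n : ℕ, ∃ u : V, u ∈ W ∧ u ∈ Nᗮ ∧ ‖u‖ = 1 ∧
      (⟪u, T u⟫).re < -((n : ℝ) + 1) * ‖j u‖ ^ 2 := by
    intro n
    obtain ⟨u, f, huf, hlt⟩ := hcon (-((n : ℝ) + 1))
    let p := N.starProjection u
    have hpN : p ∈ N := Submodule.starProjection_apply_mem N u
    have hpj : j p = 0 := LinearMap.mem_ker.1 hpN.1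
    have hpW : ∀ v, j v = 0 → ⟪v, T p⟫ = 0 := fun v hv => hpN.2 v (LinearMap.mem_ker.2 hv)
    have huW : ∀ v, j v = 0 → ⟪v, T u⟫ = 0 := fun v hv => by rw [huf, hv, inner_zero_left]
    let x := u - p
    have hxW : x ∈ W := by
      intro v hv
      have hv' : j v = 0 := LinearMap.mem_ker.1 hv
      show ⟪v, T (u - p)⟫ = 0
      rw [map_sub, inner_sub_right, huW v hv', hpW v hv', sub_zero]
    have hxN : x ∈ Nᗮ := Submodule.sub_starProjection_mem_orthogonal (K := N) u
    have hjx : j x = j u := by simp [x, hpj]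
    have hTx : ⟪x, T x⟫ = ⟪u, T u⟫ := by
      have e1 : ⟪p, T u⟫ = 0 := huW p hpj
      have e2 : ⟪p, T p⟫ = 0 := hpW p hpj
      have e3 : ⟪u, T p⟫ = 0 := by rw [hsym, inner_eq_zero_symm]; exact e1
      simp only [x, map_sub, inner_sub_left, inner_sub_right, e1, e2, e3, sub_zero]
    rw [← hjx, ← hTx] at hlt
    have hx0 : 0 < ‖x‖ := by
      rw [norm_pos_iff]; intro h; rw [h] at hlt; simp at hlt
    refine ⟨((‖x‖⁻¹ : ℝ) : ℂ) • x, W.smul_mem _ hxW, Submodule.smul_mem _ _ hxN, ?_, ?_⟩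
    · rw [norm_smul]; simp [hx0.ne']
    · rw [map_smul, map_smul, norm_smul, inner_smul_left, inner_smul_right, conj_ofReal,
        re_ofReal_mul, re_ofReal_mul, mul_pow]
      simp only [norm_real, norm_inv, norm_norm]
      have : 0 < ‖x‖⁻¹ ^ 2 := by positivity
      nlinarith
  choose u huW huN hn hlt using hex
  let F : Ultrafilter ℕ := hyperfilter ℕ
  have hF : (F : Filter ℕ) ≤ atTop := Nat.hyperfilter_le_atTop
  obtain ⟨x, hx⟩ := aux_ultra_weak F u 1 (fun n => (hn n).le)
  have hx' : ∀ v, Tendsto (fun n => ⟪v, u n⟫) F (𝓝 ⟪v, x⟫) := by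
    intro v
    have := (continuous_conj.tendsto _).comp (hx v)
    simpa [Function.comp_def, inner_conj_symm] using this
  obtain ⟨y, hy⟩ := aux_ultra_compact i hi F u 1 (fun n => (hn n).le)
  -- `j (u n) → 0`
  have hj0 : Tendsto (fun n => ‖j (u n)‖ ^ 2) F (𝓝 0) := by
    have hb : ∀ n, ‖j (u n)‖ ^ 2 ≤ ‖T‖ * (1 / ((n : ℝ) + 1)) := by
      intro n
      have h1 : -‖T‖ ≤ (⟪u n, T (u n)⟫).re := by
        have h2 := Complex.abs_re_le_norm ⟪u n, T (u n)⟫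
        have h3 := norm_inner_le_norm (𝕜 := ℂ) (u n) (T (u n))
        have h4 := T.le_opNorm (u n)
        rw [hn, one_mul] at h3
        rw [hn, mul_one] at h4
        have := neg_abs_le (⟪u n, T (u n)⟫).re
        linarith
      have h5 := hlt n
      rw [mul_one_div, le_div_iff₀ (by positivity)]
      linarith
    refine squeeze_zero (fun n => by positivity) hb ?_
    have := (tendsto_one_div_add_atTop_nhds_zero_nat (𝕜 := ℝ)).const_mul ‖T‖
    rw [mul_zero] at this
    exact this.mono_left hF
  have hj1 : Tendsto (fun n => j (u n)) F (𝓝 0) := by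
    rw [tendsto_zero_iff_norm_tendsto_zero]
    have := hj0.sqrt
    simpa [Real.sqrt_sq] using this
  have hjx : j x = 0 := by
    refine ext_inner_left ℂ fun q => ?_
    let φ : V →L[ℂ] ℂ := (innerSL ℂ q).comp j
    have h1 : Tendsto (fun n => φ (u n)) F (𝓝 ⟪q, (0 : K)⟫) :=
      (((innerSL ℂ q).continuous.tendsto (0 : K)).comp hj1)
    have h2 : ∀ v, φ v = ⟪(InnerProductSpace.toDual ℂ V).symm φ, v⟫ := fun v => by simp
    have h3 : Tendsto (fun n => φ (u n)) F (𝓝 (φ x)) := by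
      simp only [h2]; exact hx' _
    exact tendsto_nhds_unique h3 h1
  have hxW : x ∈ W := by
    intro v hv
    show ⟪v, T x⟫ = 0
    have h1 : ∀ n, ⟪T v, u n⟫ = 0 := fun n => by
      rw [← hsym]; exact huW n v hv
    have h2 := hx' (T v)
    simp only [h1] at h2
    rw [hsym]
    exact (tendsto_nhds_unique h2 tendsto_const_nhds)
  have hxN : x ∈ N := ⟨LinearMap.mem_ker.2 hjx, hxW⟩
  have hx0 : x = 0 := by
    have h2 := hx' x
    have h1 : ∀ n, ⟪x, u n⟫ = 0 := fun n => huN n x hxN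
    simp only [h1] at h2
    rw [← inner_self_eq_zero (𝕜 := ℂ)]
    exact (tendsto_nhds_unique h2 tendsto_const_nhds)
  have hy0 : y = 0 := by
    refine ext_inner_left ℂ fun q => ?_
    let φ : V →L[ℂ] ℂ := (innerSL ℂ q).comp i
    have h1 : Tendsto (fun n => φ (u n)) F (𝓝 ⟪q, y⟫) :=
      (((innerSL ℂ q).continuous.tendsto y).comp hy)
    have h2 : ∀ v, φ v = ⟪(InnerProductSpace.toDual ℂ V).symm φ, v⟫ := fun v => by simp
    have h3 : Tendsto (fun n => φ (u n)) F (𝓝 (φ x)) := by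
      simp only [h2]; exact hx' _
    rw [← tendsto_nhds_unique h3 h1, hx0]
    simp
  rw [hy0] at hy
  have hfin : Tendsto (fun n => w * ‖i (u n)‖ ^ 2) F (𝓝 0) := by
    have := (hy.norm.pow 2).const_mul w
    simpa using this
  have : m ≤ 0 := by
    refine ge_of_tendsto hfin (Filter.univ_mem' fun n => ?_)
    have h1 := hell (u n)
    have h2 := hlt n
    rw [hn] at h1
    have : 0 ≤ ((n : ℝ) + 1) * ‖j (u n)‖ ^ 2 := by positivity
    show m ≤ _
    linarith
  linarith

lemma aux_selfAdj {K : Type*} [NormedAddCommGroup K] [InnerProductSpace ℂ K]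
    (A : Set (K × K)) (hsym : ∀ q ∈ A, ∀ p ∈ A, ⟪q.1, p.2⟫ = ⟪q.2, p.1⟫) (lam : ℝ)
    (hsurj : ∀ y : K, ∃ p ∈ A, (lam : ℂ) • p.1 + p.2 = y) : IsSelfAdjointGraph A := by
  apply Set.Subset.antisymm
  · intro q hq
    obtain ⟨p, hp, hpq⟩ := hsurj ((lam : ℂ) • q.1 + q.2)
    have hr : ∀ p' ∈ A, ⟪q.1 - p.1, (lam : ℂ) • p'.1 + p'.2⟫ = 0 := by
      intro p' hp'
      have h1 := hq p' hp'
      have h2 := hsym p hp p' hp'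
      have h3 : q.2 - p.2 = -((lam : ℂ) • (q.1 - p.1)) := by
        have e : q.2 = (lam : ℂ) • p.1 + p.2 - (lam : ℂ) • q.1 := by rw [hpq]; abel
        rw [smul_sub, e]; abel
      have h4 : ⟪q.1 - p.1, p'.2⟫ = ⟪q.2 - p.2, p'.1⟫ := by
        rw [inner_sub_left, inner_sub_left, h1, h2]
      rw [inner_add_right, h4, h3, inner_neg_left, inner_smul_left, inner_smul_right, conj_ofReal]
      ring
    obtain ⟨p', hp', he⟩ := hsurj (q.1 - p.1)
    have h0 := hr p' hp'
    rw [he, inner_self_eq_zero, sub_eq_zero] at h0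
    have h1 : q.2 = p.2 := by
      rw [h0] at hpq
      exact (add_left_cancel hpq).symm
    have : q = p := Prod.ext h0 h1
    rw [this]; exact hp
  · intro q hq p hp
    exact hsym q hq p hp

lemma aux_resolvent {K : Type*} [NormedAddCommGroup K] [InnerProductSpace ℂ K]
    (A : Submodule ℂ (K × K)) (c : ℝ) (hlow : ∀ p ∈ A, c * ‖p.1‖ ^ 2 ≤ (⟪p.1, p.2⟫).re)
    (lam : ℝ) (hl : 1 ≤ lam + c) (hsurj : ∀ y : K, ∃ p ∈ A, (lam : ℂ) • p.1 + p.2 = y) :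
    ∃ R : K →L[ℂ] K, (∀ p ∈ A, R ((lam : ℂ) • p.1 + p.2) = p.1) ∧
      ∀ y, (R y, y - (lam : ℂ) • R y) ∈ A := by
  have hb : ∀ p ∈ A, ‖p.1‖ ≤ ‖(lam : ℂ) • p.1 + p.2‖ := by
    intro p hp
    have h1 := hlow p hp
    have h2 : (⟪p.1, (lam : ℂ) • p.1 + p.2⟫).re ≤ ‖p.1‖ * ‖(lam : ℂ) • p.1 + p.2‖ :=
      re_inner_le_norm (𝕜 := ℂ) _ _
    rw [inner_add_right, inner_smul_right, add_re, re_ofReal_mul] at h2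
    have h3 : (⟪p.1, p.1⟫).re = ‖p.1‖ ^ 2 := inner_self_eq_norm_sq (𝕜 := ℂ) p.1
    rw [h3] at h2
    rcases (norm_nonneg p.1).eq_or_lt with h | h
    · rw [← h]; positivity
    · have : ‖p.1‖ ^ 2 ≤ ‖p.1‖ * ‖(lam : ℂ) • p.1 + p.2‖ := by nlinarith [sq_nonneg ‖p.1‖]
      nlinarith
  have huniq : ∀ p ∈ A, ∀ q ∈ A, (lam : ℂ) • p.1 + p.2 = (lam : ℂ) • q.1 + q.2 → p.1 = q.1 := by
    intro p hp q hq h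
    have h1 := hb (p - q) (A.sub_mem hp hq)
    have h2 : (lam : ℂ) • (p - q).1 + (p - q).2 = 0 := by
      rw [Prod.fst_sub, Prod.snd_sub, smul_sub, sub_add_sub_comm, h, sub_self]
    rw [h2, norm_zero] at h1
    have := norm_le_zero_iff.1 h1
    rwa [Prod.fst_sub, sub_eq_zero] at this
  choose g hg hgy using hsurj
  let R0 : K →ₗ[ℂ] K :=
    { toFun := fun y => (g y).1
      map_add' := fun y z => by
        refine huniq _ (hg _) (g y + g z) (A.add_mem (hg _) (hg _)) ?_
        rw [hgy, Prod.fst_add, Prod.snd_add, smul_add]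
        nth_rw 1 [← hgy y, ← hgy z]
        abel
      map_smul' := fun k y => by
        refine huniq _ (hg _) (k • g y) (A.smul_mem _ (hg _)) ?_
        rw [hgy, Prod.smul_fst, Prod.smul_snd, smul_comm, ← smul_add, hgy] }
  refine ⟨R0.mkContinuous 1 fun y => ?_, fun p hp => ?_, fun y => ?_⟩
  · have := hb _ (hg y)
    rw [hgy] at this
    simpa [R0] using this
  · exact huniq _ (hg _) _ hp (hgy _)
  · have : (g y).2 = y - (lam : ℂ) • (g y).1 := by rw [eq_sub_iff_add_eq', hgy]
    show ((g y).1, y - (lam : ℂ) • (g y).1) ∈ A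
    rw [← this]; exact hg y

lemma aux_discrete {K : Type*} [NormedAddCommGroup K] [InnerProductSpace ℂ K] [CompleteSpace K]
    (A : Submodule ℂ (K × K)) (hsym : ∀ q ∈ A, ∀ p ∈ A, ⟪q.1, p.2⟫ = ⟪q.2, p.1⟫) (lam : ℝ)
    (R : K →L[ℂ] K) (hR : IsCompactOperator ⇑R)
    (hR1 : ∀ p ∈ A, R ((lam : ℂ) • p.1 + p.2) = p.1)
    (hR2 : ∀ y, (R y, y - (lam : ℂ) • R y) ∈ A) :
    HasDiscreteSpectrumGraph (A : Set (K × K)) := by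
  have heig : ∀ z ∈ GraphSpectrum (A : Set (K × K)),
      IsEigenvalueG (A : Set (K × K)) z ∧ (lam : ℂ) + z ≠ 0 := by
    intro z hz
    have hne : (lam : ℂ) + z ≠ 0 := by
      intro h0
      apply hz
      have hz' : z = -(lam : ℂ) := by linear_combination h0
      refine ⟨R, fun p hp => ?_, fun y => ⟨_, hR2 y, ?_⟩⟩
      · rw [hz', neg_smul, sub_neg_eq_add, add_comm]; exact hR1 p hp
      · rw [hz']; simp
    refine ⟨?_, hne⟩
    have hm0 : ((lam : ℂ) + z)⁻¹ ≠ 0 := inv_ne_zero hne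
    rcases IsCompactOperator.hasEigenvalue_or_mem_resolventSet hR hm0 with h | h
    · obtain ⟨y, hy⟩ := h.exists_hasEigenvector
      have h1 : R y = ((lam : ℂ) + z)⁻¹ • y := hy.apply_eq_smul
      refine ⟨y, hy.2, ?_⟩
      have h2 := A.smul_mem ((lam : ℂ) + z) (hR2 y)
      rw [Prod.smul_mk, h1, smul_inv_smul₀ hne, smul_sub, smul_comm _ (lam : ℂ),
        smul_inv_smul₀ hne, add_smul, add_sub_cancel_left] at h2
      exact h2
    · exfalso
      apply hz
      rw [spectrum.mem_resolventSet_iff] at h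
      obtain ⟨U, hU⟩ := h
      -- `U = m - R`
      have hUa : ∀ y, (U : K →L[ℂ] K) y = ((lam : ℂ) + z)⁻¹ • y - R y := by
        intro y; rw [hU]; simp [Algebra.algebraMap_eq_smul_one]
      let Ui : K →L[ℂ] K := ((U⁻¹ : (K →L[ℂ] K)ˣ) : K →L[ℂ] K)
      have hi1 : ∀ y, Ui ((U : K →L[ℂ] K) y) = y := fun y => by
        rw [← ContinuousLinearMap.mul_apply]; simp [Ui]
      have hi2 : ∀ y, (U : K →L[ℂ] K) (Ui y) = y := fun y => by
        rw [← ContinuousLinearMap.mul_apply]; simp [Ui]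
      have hkey : ∀ y x f : K, x = R y → f = y - (lam : ℂ) • x →
          f - z • x = ((lam : ℂ) + z) • (U : K →L[ℂ] K) y := by
        intro y x f hx hf
        rw [hUa, smul_sub, smul_inv_smul₀ hne, hf, ← hx, add_smul]
        abel
      refine ⟨((lam : ℂ) + z)⁻¹ • R.comp Ui, fun p hp => ?_, fun y => ?_⟩
      · rw [hkey ((lam : ℂ) • p.1 + p.2) p.1 p.2 (hR1 p hp).symm (by abel)]
        simp only [map_smul, ContinuousLinearMap.smul_apply, ContinuousLinearMap.comp_apply, hi1,
          hR1 p hp]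
        rw [smul_inv_smul₀ hne]
      · refine ⟨_, hR2 (((lam : ℂ) + z)⁻¹ • Ui y), ?_⟩
        rw [hkey (((lam : ℂ) + z)⁻¹ • Ui y) _ _ rfl rfl, map_smul, hi2, smul_inv_smul₀ hne]
  have hreal : ∀ z, IsEigenvalueG (A : Set (K × K)) z → conj z = z := by
    rintro z ⟨x, hx, hxA⟩
    have h := hsym _ hxA _ hxA
    simp only [inner_smul_left, inner_smul_right] at h
    exact (mul_right_cancel₀ (inner_self_ne_zero.2 hx) h).symm
  intro z hz
  obtain ⟨hze, hzne⟩ := heig z hz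
  refine ⟨hze, ?_⟩
  by_contra! hcon
  have hex : ∀ n : ℕ, ∃ w : ℂ, ∃ x : K, w ≠ z ∧ ‖w - z‖ ≤ 1 / ((n : ℝ) + 1) ∧ ‖x‖ = 1 ∧
      (x, w • x) ∈ A := by
    intro n
    obtain ⟨w, hw, hwz, hlt⟩ := hcon (1 / ((n : ℝ) + 1)) (by positivity)
    obtain ⟨⟨x, hx, hxA⟩, -⟩ := heig w hw
    have hx0 : 0 < ‖x‖ := norm_pos_iff.2 hx
    refine ⟨w, ((‖x‖⁻¹ : ℝ) : ℂ) • x, hwz, hlt.le, ?_, ?_⟩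
    · rw [norm_smul]; simp [hx0.ne']
    · have := A.smul_mem ((‖x‖⁻¹ : ℝ) : ℂ) hxA
      rwa [Prod.smul_mk, smul_comm] at this
  choose w x hwz hwl hx1 hxA using hex
  let F : Ultrafilter ℕ := hyperfilter ℕ
  have hF : (F : Filter ℕ) ≤ atTop := Nat.hyperfilter_le_atTop
  obtain ⟨y, hy⟩ := aux_ultra_compact R hR F x 1 (fun n => (hx1 n).le)
  have hw : Tendsto w F (𝓝 z) := by
    rw [tendsto_iff_norm_sub_tendsto_zero]
    exact squeeze_zero (fun n => norm_nonneg _) hwl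
      (tendsto_one_div_add_atTop_nhds_zero_nat.mono_left hF)
  have hxe : ∀ n, x n = ((lam : ℂ) + w n) • R (x n) := by
    intro n
    have := hR1 _ (hxA n)
    simp only [← add_smul, map_smul] at this
    exact this.symm
  have hxl : Tendsto x F (𝓝 (((lam : ℂ) + z) • y)) := by
    have h1 := (hw.const_add (lam : ℂ)).smul hy
    exact h1.congr fun n => (hxe n).symm
  set x0 := ((lam : ℂ) + z) • y with hx0
  have hRx : R x0 = y := tendsto_nhds_unique ((R.continuous.tendsto _).comp hxl) hy
  have hx0A : (x0, z • x0) ∈ A := by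
    have h2 := A.smul_mem ((lam : ℂ) + z) (hR2 x0)
    rw [hRx, Prod.smul_mk, smul_sub, smul_comm _ (lam : ℂ), ← hx0, add_smul,
      add_sub_cancel_left] at h2
    exact h2
  have hx0n : ‖x0‖ = 1 := by
    have h1 := hxl.norm
    simp only [hx1] at h1
    exact (tendsto_nhds_unique h1 tendsto_const_nhds)
  have horth : ∀ n, ⟪x0, x n⟫ = 0 := by
    intro n
    have h := hsym _ hx0A _ (hxA n)
    simp only [inner_smul_left, inner_smul_right] at h
    rw [hreal z hze, ← sub_eq_zero, ← sub_mul] at h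
    exact (mul_eq_zero.1 h).resolve_left (sub_ne_zero.2 (hwz n))
  have hlim := ((innerSL ℂ x0).continuous.tendsto x0).comp hxl
  have hlim' : Tendsto (fun n => ⟪x0, x n⟫) F (𝓝 ⟪x0, x0⟫) := hlim
  simp only [horth] at hlim'
  have := tendsto_nhds_unique hlim' tendsto_const_nhds
  rw [inner_self_eq_zero] at this
  rw [this] at hx0n; simp at hx0n

lemma aux_main {V K : Type*}
    [NormedAddCommGroup V] [InnerProductSpace ℂ V] [CompleteSpace V]
    [NormedAddCommGroup K] [InnerProductSpace ℂ K] [CompleteSpace K]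
    (a : V → V → ℂ) (j : V →L[ℂ] K) (T : V →L[ℂ] V) (hT : ∀ u v, a u v = ⟪v, T u⟫)
    (hsym : ∀ u v, ⟪u, T v⟫ = ⟪T u, v⟫) (c : ℝ)
    (hlow : ∀ u f, (∀ v, ⟪v, T u⟫ = ⟪j v, f⟫) → c * ‖j u‖ ^ 2 ≤ (⟪u, T u⟫).re)
    (lam₀ : ℝ) (C : V →L[ℂ] V) (hC : IsCompactOperator ⇑C) (m : ℝ) (hm : 0 < m)
    (hcoer : ∀ u, m * ‖u‖ ^ 2 ≤ (⟪u, T u⟫).re + lam₀ * ‖j u‖ ^ 2 + (⟪u, C u⟫).re) :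
    IsSelfAdjointGraph (GraphOf a j) ∧ IsLowerBoundedGraph (GraphOf a j) ∧
      (IsCompactOperator ⇑j →
        HasCompactResolventGraph (GraphOf a j) ∧ HasDiscreteSpectrumGraph (GraphOf a j)) := by
  let A : Submodule ℂ (K × K) :=
    { carrier := GraphOf a j
      zero_mem' := ⟨0, by simp, fun v => by simp [hT]⟩
      add_mem' := by
        rintro p q ⟨u, hu, hp⟩ ⟨v, hv, hq⟩
        refine ⟨u + v, by simp [hu, hv], fun w => ?_⟩
        rw [hT, map_add, inner_add_right, ← hT, ← hT, hp, hq, Prod.snd_add, inner_add_right]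
      smul_mem' := by
        rintro k p ⟨u, hu, hp⟩
        refine ⟨k • u, by simp [hu], fun w => ?_⟩
        rw [hT, map_smul, inner_smul_right, ← hT, hp, Prod.smul_snd, inner_smul_right] }
  have hAG : (A : Set (K × K)) = GraphOf a j := rfl
  have hAsym : ∀ q ∈ A, ∀ p ∈ A, ⟪q.1, p.2⟫ = ⟪q.2, p.1⟫ := by
    rintro q ⟨u, hu, hq⟩ p ⟨v, hv, hp⟩
    rw [hu, hv, ← hp, ← inner_conj_symm, ← hq, hT, hT, inner_conj_symm, hsym]
  have hAlow : ∀ p ∈ A, c * ‖p.1‖ ^ 2 ≤ (⟪p.1, p.2⟫).re := by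
    rintro p ⟨u, hu, hp⟩
    rw [hu, ← hp, hT]
    exact hlow u p.2 fun v => by rw [← hT, hp]
  have hres : ∀ lam : ℝ, max lam₀ (1 - c) ≤ lam → ∃ k : ℝ, 0 ≤ k ∧ ∀ y : K, ∃ u : V,
      (j u, y - (lam : ℂ) • j u) ∈ A ∧ ‖u‖ ≤ k * ‖y‖ := by
    intro lam hlam
    have hl1 := (le_max_left _ _).trans hlam
    have hl2 := (le_max_right _ _).trans hlam
    let J := ContinuousLinearMap.adjoint j
    let S : V →L[ℂ] V := T + (lam : ℂ) • J.comp j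
    have hS : ∀ u v, ⟪v, S u⟫ = ⟪v, T u⟫ + (lam : ℂ) * ⟪j v, j u⟫ := by
      intro u v
      simp [S, J, inner_add_right, inner_smul_right, ContinuousLinearMap.adjoint_inner_right]
    have hSsym : ∀ u v, ⟪u, S v⟫ = ⟪S u, v⟫ := by
      intro u v
      rw [← inner_conj_symm (S u) v, hS, hS, map_add, map_mul, conj_ofReal, inner_conj_symm,
        inner_conj_symm, hsym]
    obtain ⟨k, hk, hrange⟩ := aux_range S C hC m hm hSsym (fun u => by
      rw [hS, add_re, re_ofReal_mul]
      have h3 : (⟪j u, j u⟫).re = ‖j u‖ ^ 2 := inner_self_eq_norm_sq (𝕜 := ℂ) (j u)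
      rw [h3]
      have := hcoer u
      nlinarith [sq_nonneg ‖j u‖])
    refine ⟨k * ‖J‖, by positivity, fun y => ?_⟩
    have hker : ∀ w, S w = 0 → j w = 0 := by
      intro w hw
      have h1 : ∀ v, ⟪v, T w⟫ = ⟪j v, -((lam : ℂ) • j w)⟫ := by
        intro v
        have := hS w v
        rw [hw, inner_zero_right] at this
        rw [inner_neg_right, inner_smul_right]
        linear_combination -this
      have h2 := hlow w _ h1
      rw [h1, inner_neg_right, inner_smul_right, neg_re, re_ofReal_mul] at h2
      have h3 : (⟪j w, j w⟫).re = ‖j w‖ ^ 2 := inner_self_eq_norm_sq (𝕜 := ℂ) (j w)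
      rw [h3] at h2
      have h4 : ‖j w‖ ^ 2 ≤ 0 := by nlinarith [sq_nonneg ‖j w‖]
      exact norm_eq_zero.1 (pow_eq_zero_iff (two_ne_zero) |>.1 (le_antisymm h4 (sq_nonneg _)))
    obtain ⟨u, hu, hn⟩ := hrange (J y) (fun w hw => by
      simp [J, ContinuousLinearMap.adjoint_inner_right, hker w hw])
    refine ⟨u, ⟨u, rfl, fun v => ?_⟩, ?_⟩
    · have h1 := hS u v
      rw [hu, ContinuousLinearMap.adjoint_inner_right] at h1
      rw [hT, inner_sub_right, inner_smul_right]
      linear_combination -h1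
    · have := J.le_opNorm y
      calc ‖u‖ ≤ k * ‖J y‖ := hn
        _ ≤ k * (‖J‖ * ‖y‖) := by gcongr
        _ = _ := by ring
  have hsurj : ∀ lam : ℝ, max lam₀ (1 - c) ≤ lam → ∀ y : K, ∃ p ∈ A,
      (lam : ℂ) • p.1 + p.2 = y := by
    intro lam hlam y
    obtain ⟨k, -, h⟩ := hres lam hlam
    obtain ⟨u, hu, -⟩ := h y
    exact ⟨_, hu, by simp⟩
  refine ⟨aux_selfAdj _ hAsym _ (hsurj _ le_rfl), ⟨c, hAlow⟩, fun hj => ?_⟩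
  have hcomp : ∀ lam : ℝ, max lam₀ (1 - c) ≤ lam → ∃ R : K →L[ℂ] K, IsCompactOperator ⇑R ∧
      (∀ p ∈ A, R ((lam : ℂ) • p.1 + p.2) = p.1) ∧ ∀ y, (R y, y - (lam : ℂ) • R y) ∈ A := by
    intro lam hlam
    have hl2 := (le_max_right _ _).trans hlam
    obtain ⟨R, h1, h2⟩ := aux_resolvent A c hAlow lam (by linarith) (hsurj lam hlam)
    refine ⟨R, ?_, h1, h2⟩
    obtain ⟨k, hk, h⟩ := hres lam hlam
    obtain ⟨Q, hQ, hsub⟩ := IsCompactOperator.image_closedBall_subset_compact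
      (f := (j : V →ₗ[ℂ] K)) hj k
    refine (isCompactOperator_iff_image_closedBall_subset_compact (R : K →ₗ[ℂ] K)
      (r := 1) one_pos).2 ⟨Q, hQ, ?_⟩
    rintro _ ⟨y, hy, rfl⟩
    obtain ⟨u, hu, hn⟩ := h y
    have hy1 : ‖y‖ ≤ 1 := by simpa using hy
    have h3 := h1 _ hu
    simp only [add_sub_cancel] at h3
    show R y ∈ Q
    rw [h3]
    exact hsub ⟨u, by simpa using hn.trans (by nlinarith), rfl⟩
  refine ⟨⟨max lam₀ (1 - c), fun lam hlam => ?_⟩, ?_⟩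
  · obtain ⟨R, hR, h1, h2⟩ := hcomp lam hlam
    exact ⟨R, hR, h1, fun y => ⟨_, h2 y, by simp⟩⟩
  · obtain ⟨R, hR, h1, h2⟩ := hcomp _ le_rfl
    exact aux_discrete A hAsym _ R hR h1 h2

end Helpers

/-- Proposition 2.1.
Let `V`, `K` be Hilbert spaces, `a : V × V → ℂ` a continuous symmetric sesquilinear form and
`j : V → K` a continuous linear map.  Suppose that (a) `a` is `j`-elliptic, or (b) there is a
Hilbert space `H` and a compact linear map `i : V → H` such that `a` is `i`-elliptic.
Then the graph `A` associated with `(a, j)` is a lower bounded self-adjoint graph.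
Moreover, if `j` is compact, then `A` has compact resolvent and in particular discrete
spectrum. -/
theorem statement0
    {V K : Type*}
    [NormedAddCommGroup V] [InnerProductSpace ℂ V] [CompleteSpace V]
    [NormedAddCommGroup K] [InnerProductSpace ℂ K] [CompleteSpace K]
    (a : V → V → ℂ) (j : V →L[ℂ] K)
    (hsesq : IsSesqui a) (hcont : IsContinuousForm a) (hsymm : IsSymmForm a)
    (hell : IsElliptic a ⇑j ∨
      ∃ (H : Type _) (nG : NormedAddCommGroup H),
        letI := nG
        ∃ iS : InnerProductSpace ℂ H,
          letI := iS
          CompleteSpace H ∧ ∃ i : V →L[ℂ] H, IsCompactOperator ⇑i ∧ IsElliptic a ⇑i) :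
    IsSelfAdjointGraph (GraphOf a j) ∧ IsLowerBoundedGraph (GraphOf a j) ∧
      (IsCompactOperator ⇑j →
        HasCompactResolventGraph (GraphOf a j) ∧ HasDiscreteSpectrumGraph (GraphOf a j)) := by
  obtain ⟨T, hT⟩ := aux_exists_op a hsesq hcont
  have hsym : ∀ u v, ⟪u, T v⟫ = ⟪T u, v⟫ := by
    intro u v
    rw [← hT, hsymm, hT, inner_conj_symm]
  rcases hell with ⟨w, m, hw, hm, h⟩ | ⟨H, nG, iS, hH, i, hi, w, m, hw, hm, h⟩
  · refine aux_main a j T hT hsym (-w) (fun u f _ => ?_) w 0 isCompactOperator_zero m hm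
      (fun u => ?_)
    · have := h u
      rw [hT] at this
      nlinarith [sq_nonneg ‖u‖]
    · have := h u
      rw [hT] at this
      simpa using this
  · have h' : ∀ u, m * ‖u‖ ^ 2 ≤ (⟪u, T u⟫).re + w * ‖i u‖ ^ 2 := fun u => by
      rw [← hT]; exact h u
    obtain ⟨c, hc⟩ := aux_lower T hsym j i hi w m hw hm h'
    refine aux_main a j T hT hsym c hc 0 ((w : ℂ) • (ContinuousLinearMap.adjoint i).comp i)
      ((hi.clm_comp (ContinuousLinearMap.adjoint i)).smul (w : ℂ)) m hm (fun u => ?_)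
    have h3 : (⟪i u, i u⟫).re = ‖i u‖ ^ 2 := inner_self_eq_norm_sq (𝕜 := ℂ) (i u)
    rw [ContinuousLinearMap.smul_apply, inner_smul_right, re_ofReal_mul,
      ContinuousLinearMap.comp_apply, ContinuousLinearMap.adjoint_inner_right, h3]
    simpa using h' u
end
end

section
/- Let V, H, K be Hilbert spaces, with V embedded in H via a compact inclusion i : V → H, and let j : V → K be a compact linear map. Let 𝔞 : V × V → ℂ be a positive symmetric continuous i-elliptic sesquilinear form, V_D = ker j, A^N the self-adjoint operator in the closure of V in H associated with 𝔞, and A^D the self-adjoint operator in the closure of V_D in H associated with 𝔞 restricted to V_D × V_D. For λ ∈ ℝ define 𝔟_λ(u,v) = 𝔞(u,v) − λ(u,v)_H and let N_λ be the self-adjoint graph associated with (𝔟_λ, j). Suppose that (I) A^N has no eigenvector in V_D, and (II) for every λ ∈ (0,∞), the span of {φ ∈ D(N_λ) : (N_λ° φ, φ)_K = 0} is infinite-dimensional, where N_λ° is the single-valued part of N_λ. If λ₁^N ≤ λ₂^N ≤ … and λ₁^D ≤ λ₂^D ≤ … are the eigenvalues of A^N and A^D repeated with multiplicity, then λ_{n+1}^N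 < λ_n^D for all n ∈ ℕ. -/
/-!
Abstract framework for forms, graphs (linear relations) and their spectra,
following Arendt--ter Elst style form methods.
-/

noncomputable section
open Complex Filter Topology ComplexConjugate

local notation "⟪" x ", " y "⟫" => @inner ℂ _ _ x y

section Proof

variable {V H : Type*}
variable [NormedAddCommGroup V] [InnerProductSpace ℂ V]
variable [NormedAddCommGroup H] [InnerProductSpace ℂ H]

/-- The form `(u, v) ↦ (i u, i v)_H`. -/
def gramForm (i : V →L[ℂ] H) : V →ₗ[ℂ] V →ₗ⋆[ℂ] ℂ :=
  LinearMap.mk₂'ₛₗ (RingHom.id ℂ) (starRingEnd ℂ) (fun u v => ⟪i v, i u⟫)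
    (by intros; simp) (by intros; simp)
    (by intros; simp) (by intros; simp [mul_comm])

theorem gramForm_apply (i : V →L[ℂ] H) (u v : V) : gramForm i u v = ⟪i v, i u⟫ := rfl

theorem gramForm_self_re (i : V →L[ℂ] H) (u : V) : (gramForm i u u).re = ‖i u‖ ^ 2 := by
  rw [gramForm_apply, inner_self_eq_norm_sq_to_K]
  norm_cast

/-- A vector that annihilates a nonnegative form is in its kernel. -/
theorem degenerate_cs (Q : V →ₗ[ℂ] V →ₗ⋆[ℂ] ℂ) (hs : ∀ u v, Q v u = conj (Q u v)) (w v : V)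
    (hw : Q w w = 0) (h : ∀ c : ℂ, 0 ≤ (Q (v + c • w) (v + c • w)).re) : Q w v = 0 := by
  by_contra hz
  set z := Q w v with hzdef
  have hv : Q v w = conj z := hs w v
  have key : ∀ s : ℝ, 0 ≤ (Q v v).re + 2 * s * normSq z := by
    intro s
    have := h (s * conj z)
    simp only [map_add, LinearMap.add_apply, LinearMap.map_smulₛₗ,
      LinearMap.smul_apply, hw, hv, ← hzdef, smul_eq_mul] at this
    simp [normSq_apply] at this ⊢
    nlinarith
  have hpos : 0 < normSq z := normSq_pos.mpr hz
  have := key (-((Q v v).re + 1) / (2 * normSq z))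
  field_simp at this
  linarith

/-- Bounded sequences have subsequences whose image under a compact operator converges. -/
theorem compact_subseq (i : V →L[ℂ] H) (hi : IsCompactOperator ⇑i) (x : ℕ → V) (R : ℝ)
    (hx : ∀ n, ‖x n‖ ≤ R) :
    ∃ (h : H) (φ : ℕ → ℕ), StrictMono φ ∧ Tendsto (fun n => i (x (φ n))) atTop (𝓝 h) := by
  obtain ⟨C, hC, hsub⟩ := hi.image_closedBall_subset_compact (f := (i : V →ₗ[ℂ] H)) R
  have := hC.tendsto_subseq (x := fun n => i (x n)) (fun n => hsub ⟨x n, by simpa using hx n, rfl⟩)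
  obtain ⟨h, -, φ, h1, h2⟩ := this
  exact ⟨h, φ, h1, h2⟩

/-- The eigenspace of the form `A` on the domain `D`. -/
def eigS (A : V →ₗ[ℂ] V →ₗ⋆[ℂ] ℂ) (i : V →L[ℂ] H) (D : Submodule ℂ V) (t : ℝ) :
    Submodule ℂ V where
  carrier := {u | u ∈ D ∧ ∀ v ∈ D, A u v = t * gramForm i u v}
  add_mem' := by
    rintro x y ⟨hx, hx'⟩ ⟨hy, hy'⟩
    refine ⟨D.add_mem hx hy, fun v hv => ?_⟩
    simp [hx' v hv, hy' v hv]; ring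
  zero_mem' := ⟨D.zero_mem, by simp⟩
  smul_mem' := by
    rintro c x ⟨hx, hx'⟩
    refine ⟨D.smul_mem c hx, fun v hv => ?_⟩
    simp [hx' v hv]; ring

/-- finite dimensionality of eigenspaces -/
theorem eigS_finite (A : V →ₗ[ℂ] V →ₗ⋆[ℂ] ℂ) (i : V →L[ℂ] H) (hi : IsCompactOperator ⇑i)
    (ω μ : ℝ) (hω : 0 < ω) (hμ : 0 < μ)
    (hell : ∀ u, μ * ‖u‖ ^ 2 ≤ (A u u).re + ω * ‖i u‖ ^ 2) (t : ℝ) :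
    FiniteDimensional ℂ (eigS A i ⊤ t) := by
  by_contra hfin
  obtain ⟨R, f, -, hf, hsep⟩ := exists_seq_norm_le_one_le_norm_sub (𝕜 := ℂ) (E := eigS A i ⊤ t) hfin
  obtain ⟨h, φ, hφ, hlim⟩ := compact_subseq i hi (fun n => (f n : V)) R (fun n => hf n)
  have hC := hlim.cauchySeq
  have hb : ∀ u ∈ eigS A i ⊤ t, μ * ‖u‖ ^ 2 ≤ (|t| + ω) * ‖i u‖ ^ 2 := by
    intro u hu
    have h1 := hell u
    rw [hu.2 u trivial, re_ofReal_mul, gramForm_self_re] at h1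
    nlinarith [le_abs_self t, sq_nonneg ‖i u‖]
  have hpos : 0 < |t| + ω := by positivity
  rw [Metric.cauchySeq_iff'] at hC
  obtain ⟨N, hN⟩ := hC (Real.sqrt (μ / (|t| + ω))) (by positivity)
  have h1 := hN (N+1) (by omega)
  rw [dist_eq_norm, ← map_sub] at h1
  have h2 := hb _ (f (φ (N+1)) - f (φ N)).2
  have h3 := hsep (i := φ (N+1)) (j := φ N) (fun h => by have := hφ.injective h; omega)
  simp only [Submodule.coe_norm] at h3
  have h4 : ‖i (↑(f (φ (N+1))) - ↑(f (φ N)))‖ ^ 2 < μ / (|t| + ω) := by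
    rw [← Real.lt_sqrt (norm_nonneg _)]; exact h1
  rw [lt_div_iff₀ hpos] at h4
  rw [Submodule.coe_sub] at h2 h3
  have h5 : 1 ≤ ‖(f (φ (N+1)) : V) - (f (φ N) : V)‖ ^ 2 := one_le_pow₀ h3
  nlinarith


theorem min_eig [CompleteSpace V] (A : V →ₗ[ℂ] V →ₗ⋆[ℂ] ℂ) (hs : ∀ u v, A v u = conj (A u v))
    (hp : ∀ u, 0 ≤ (A u u).re) (M : ℝ) (hM : ∀ u v, ‖A u v‖ ≤ M * ‖u‖ * ‖v‖)
    (i : V →L[ℂ] H) (hinj : Function.Injective ⇑i) (hi : IsCompactOperator ⇑i)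
    (ω μ : ℝ) (hω : 0 < ω) (hμ : 0 < μ)
    (hell : ∀ u, μ * ‖u‖ ^ 2 ≤ (A u u).re + ω * ‖i u‖ ^ 2)
    (F : Submodule ℂ V) (hF : IsClosed (F : Set V)) (w₀ : V) (hw₀ : w₀ ∈ F) (hne : w₀ ≠ 0)
    (lam : ℝ) (hle : (A w₀ w₀).re ≤ lam * ‖i w₀‖ ^ 2) :
    ∃ t ≤ lam, ∃ w ∈ eigS A i F t, w ≠ 0 := by
  set S : Set ℝ := {r | ∃ w ∈ F, ‖i w‖ = 1 ∧ r = (A w w).re} with hS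
  have hnorm : ∀ w ∈ F, w ≠ 0 → (A w w).re / ‖i w‖ ^ 2 ∈ S := by
    intro w hw hw0
    have h0 : ‖i w‖ ≠ 0 := by
      rw [norm_ne_zero_iff]; intro h; exact hw0 (hinj (by simpa using h))
    refine ⟨((‖i w‖⁻¹ : ℝ) : ℂ) • w, F.smul_mem _ hw, ?_, ?_⟩
    · rw [map_smul, norm_smul]; simp [h0]
    · simp only [map_smul, LinearMap.map_smulₛₗ, LinearMap.smul_apply, smul_eq_mul, conj_ofReal,
        re_ofReal_mul]
      field_simp
  have hbdd : BddBelow S := ⟨0, by rintro r ⟨w, -, -, rfl⟩; exact hp w⟩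
  have hnon : S.Nonempty := ⟨_, hnorm w₀ hw₀ hne⟩
  set t := sInf S with ht
  have ht0 : 0 ≤ t := le_csInf hnon (by rintro r ⟨w, -, -, rfl⟩; exact hp w)
  have hpos : ∀ w, w ≠ 0 → 0 < ‖i w‖ ^ 2 := by
    intro w hw
    have : i w ≠ 0 := fun h => hw (hinj (by simpa using h))
    positivity
  have hge : ∀ w ∈ F, t * ‖i w‖ ^ 2 ≤ (A w w).re := by
    intro w hw
    rcases eq_or_ne w 0 with rfl | h0
    · simp
    · have := csInf_le hbdd (hnorm w hw h0)
      rwa [le_div_iff₀ (hpos w h0)] at this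
  have htl : t ≤ lam := by
    have := csInf_le hbdd (hnorm w₀ hw₀ hne)
    rw [le_div_iff₀ (hpos w₀ hne)] at this
    exact le_of_mul_le_mul_right (this.trans hle) (hpos w₀ hne)
  obtain ⟨r, -, hr, hrS⟩ := exists_seq_tendsto_sInf hnon hbdd
  choose x hxF hx1 hxr using hrS
  obtain ⟨C, hC⟩ := hr.bddAbove_range
  have hxb : ∀ n, ‖x n‖ ≤ Real.sqrt ((C + ω) / μ) := by
    intro n
    apply Real.le_sqrt_of_sq_le
    rw [le_div_iff₀ hμ]
    have h1 := hell (x n)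
    have h2 : r n ≤ C := hC ⟨n, rfl⟩
    rw [hx1 n, ← hxr n] at h1
    linarith
  obtain ⟨h, φ, hφ, hlim⟩ := compact_subseq i hi x _ hxb
  have hr' : Tendsto (fun n => r (φ n)) atTop (𝓝 t) := hr.comp hφ.tendsto_atTop
  have hpar : ∀ n m, μ * ‖x n - x m‖ ^ 2 ≤
      2 * (r n - t) + 2 * (r m - t) + (t + ω) * ‖i (x n) - i (x m)‖ ^ 2 := by
    intro n m
    have h1 := hell (x n - x m)
    have h2 := hge (x n + x m) (F.add_mem (hxF n) (hxF m))
    have h3 := parallelogram_law_with_norm ℂ (i (x n)) (i (x m))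
    rw [hx1, hx1] at h3
    rw [map_add i] at h2
    rw [map_sub i] at h1
    have h4 : (A (x n + x m) (x n + x m)).re + (A (x n - x m) (x n - x m)).re
        = 2 * r n + 2 * r m := by
      rw [hxr n, hxr m]
      simp only [map_add, map_sub, LinearMap.add_apply, LinearMap.sub_apply, add_re, sub_re]
      ring
    have h5 : ‖i (x n) + i (x m)‖ ^ 2 = 4 - ‖i (x n) - i (x m)‖ ^ 2 := by linarith
    rw [h5] at h2
    linarith
  have hcau : CauchySeq (fun n => x (φ n)) := by
    rw [Metric.cauchySeq_iff']
    intro ε hε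
    have hC := hlim.cauchySeq
    rw [Metric.cauchySeq_iff] at hC
    obtain ⟨N₁, hN₁⟩ := hC (Real.sqrt (μ * ε ^ 2 / (2 * (t + ω)))) (by positivity)
    have h2 : ∀ᶠ n in atTop, r (φ n) < t + μ * ε ^ 2 / 8 :=
      hr'.eventually_lt_const (by have : 0 < μ * ε ^ 2 / 8 := by positivity
                                  linarith)
    obtain ⟨N₂, hN₂⟩ := eventually_atTop.mp h2
    refine ⟨max N₁ N₂, fun n hn => ?_⟩
    have e1 := hN₁ n (le_trans (le_max_left _ _) hn) (max N₁ N₂) (le_max_left _ _)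
    have e2 := hN₂ n (le_trans (le_max_right _ _) hn)
    have e3 := hN₂ (max N₁ N₂) (le_max_right _ _)
    have e4 := hpar (φ n) (φ (max N₁ N₂))
    rw [dist_eq_norm] at e1 ⊢
    rw [Real.lt_sqrt (norm_nonneg _), lt_div_iff₀ (by positivity)] at e1
    have : μ * ‖x (φ n) - x (φ (max N₁ N₂))‖ ^ 2 < μ * ε ^ 2 := by linarith
    exact lt_of_pow_lt_pow_left₀ 2 hε.le (lt_of_mul_lt_mul_left this hμ.le)
  obtain ⟨w, hw⟩ := cauchySeq_tendsto_of_complete hcau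
  have hwF : w ∈ F := hF.mem_of_tendsto hw (Eventually.of_forall fun n => hxF _)
  have hw1 : ‖i w‖ = 1 := by
    have h1 : Tendsto (fun n => ‖i (x (φ n))‖) atTop (𝓝 ‖i w‖) :=
      ((i.continuous.norm).tendsto w).comp hw
    simp only [hx1] at h1
    exact tendsto_nhds_unique h1 tendsto_const_nhds
  have hwt : (A w w).re = t := by
    have hc : Continuous (fun u => (A u u).re) := by
      have h1 : Continuous (fun u : V => A u u) := by
        rw [continuous_iff_continuousAt]
        intro y
        rw [ContinuousAt, tendsto_iff_norm_sub_tendsto_zero]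
        have hb : ∀ u, ‖A u u - A y y‖ ≤ M * ‖u - y‖ * ‖u‖ + M * ‖y‖ * ‖u - y‖ := by
          intro u
          have e : A u u - A y y = A (u - y) u + A y (u - y) := by
            simp only [map_sub, LinearMap.sub_apply]; ring
          rw [e]
          exact (norm_add_le _ _).trans (add_le_add (hM _ _) (hM _ _))
        refine squeeze_zero (fun _ => norm_nonneg _) hb ?_
        have hc : Continuous (fun u : V => M * ‖u - y‖ * ‖u‖ + M * ‖y‖ * ‖u - y‖) := by fun_prop
        simpa using hc.tendsto y
      exact Complex.continuous_re.comp h1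
    have h1 := (hc.tendsto w).comp hw
    have h2 : Tendsto (fun n => r (φ n)) atTop (𝓝 (A w w).re) := by
      simp only [hxr]; exact h1
    exact tendsto_nhds_unique h2 hr'
  refine ⟨t, htl, w, ⟨hwF, fun v hv => ?_⟩, fun h0 => by simp [h0] at hw1⟩
  have hre : ∀ u, ((A - (t : ℂ) • gramForm i) u u).re = (A u u).re - t * ‖i u‖ ^ 2 := by
    intro u
    simp only [LinearMap.sub_apply, LinearMap.smul_apply, sub_re, smul_eq_mul, re_ofReal_mul,
      gramForm_self_re]
  have hsym : ∀ u v, (A - (t : ℂ) • gramForm i) v u = conj ((A - (t : ℂ) • gramForm i) u v) := by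
    intro u v
    simp [gramForm_apply, hs u v]
  have := degenerate_cs (A - (t : ℂ) • gramForm i) hsym w v ?_ ?_
  · simpa [sub_eq_zero] using this
  · apply Complex.ext
    · rw [hre, hwt, hw1]; simp
    · exact conj_eq_iff_im.mp (hsym w w).symm
  · intro c
    rw [hre]
    have := hge (v + c • w) (F.add_mem hv (F.smul_mem c hwF))
    linarith

theorem eig_orth (A : V →ₗ[ℂ] V →ₗ⋆[ℂ] ℂ) (hs : ∀ u v, A v u = conj (A u v))
    (i : V →L[ℂ] H) (D : Submodule ℂ V) (s t : ℝ) (hst : s ≠ t) (u v : V)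
    (hu : u ∈ eigS A i D s) (hv : v ∈ eigS A i D t) : ⟪i u, i v⟫ = 0 := by
  have h1 := hu.2 v hv.1
  have h2 := hv.2 u hu.1
  rw [hs u v, h1] at h2
  simp only [gramForm_apply, map_mul, conj_ofReal, inner_conj_symm] at h2
  have h3 : ((s : ℂ) - t) * ⟪i u, i v⟫ = 0 := by rw [sub_mul, h2, sub_self]
  rcases mul_eq_zero.mp h3 with h | h
  · exact absurd (by exact_mod_cast sub_eq_zero.mp h) hst
  · exact h

theorem eig_basis (A : V →ₗ[ℂ] V →ₗ⋆[ℂ] ℂ) (hs : ∀ u v, A v u = conj (A u v))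
    (i : V →L[ℂ] H) (hinj : Function.Injective ⇑i) (D : Submodule ℂ V) (lam : ℕ → ℝ)
    (hfin : ∀ t : ℝ, {n : ℕ | lam n = t}.Finite)
    (hcard : ∀ t : ℝ, Nat.card {n : ℕ | lam n = t} = Module.finrank ℂ (eigS A i D t)) :
    ∃ e : ℕ → V, Orthonormal ℂ (fun k => i (e k)) ∧ (∀ k, e k ∈ eigS A i D (lam k)) ∧
      ∀ t, FiniteDimensional ℂ (eigS A i D t) →
        eigS A i D t ≤ Submodule.span ℂ (e '' {k | lam k = t}) := by
  have key : ∀ t : ℝ, ∃ f : {n : ℕ | lam n = t} → V, Orthonormal ℂ (fun k => i (f k)) ∧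
      (∀ k, f k ∈ eigS A i D t) ∧ (FiniteDimensional ℂ (eigS A i D t) →
        eigS A i D t ≤ Submodule.span ℂ (Set.range f)) := by
    intro t
    have := (hfin t).to_subtype
    letI := Fintype.ofFinite {n : ℕ | lam n = t}
    by_cases hfd : FiniteDimensional ℂ (eigS A i D t)
    · set Y := (eigS A i D t).map (i : V →ₗ[ℂ] H) with hY
      have eY : Module.finrank ℂ Y = Module.finrank ℂ (eigS A i D t) :=
        ((eigS A i D t).equivMapOfInjective (i : V →ₗ[ℂ] H) hinj).finrank_eq.symm
      have : FiniteDimensional ℂ Y := by rw [hY]; infer_instance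
      let σ : {n : ℕ | lam n = t} ≃ Fin (Module.finrank ℂ Y) :=
        Finite.equivFinOfCardEq ((hcard t).trans eY.symm)
      let b := (stdOrthonormalBasis ℂ Y).reindex σ.symm
      have hb : ∀ k, ∃ u ∈ eigS A i D t, i u = (b k : H) := fun k => (b k).2
      choose f hf hfb using hb
      refine ⟨f, ?_, hf, fun _ u hu => ?_⟩
      · have h1 := b.orthonormal.comp_linearIsometry Y.subtypeₗᵢ
        have h2 : (fun k => i (f k)) = (Y.subtypeₗᵢ ∘ b) := by
          funext k; simp [hfb]
        rw [h2]; exact h1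
      · let y : Y := ⟨i u, ⟨u, hu, rfl⟩⟩
        have h1 := b.sum_repr y
        have h2 : i (∑ k, b.repr y k • f k) = i u := by
          have := congrArg (Subtype.val) h1
          simp only [Submodule.coe_sum, Submodule.coe_smul] at this
          rw [map_sum]
          simp only [map_smul, hfb]
          exact this
        rw [← hinj h2]
        exact Submodule.sum_mem _ fun k _ => Submodule.smul_mem _ _ (Submodule.subset_span ⟨k, rfl⟩)
    · have h0 : Module.finrank ℂ (eigS A i D t) = 0 := Module.finrank_of_infinite_dimensional hfd
      have h1 := hcard t
      rw [h0, Finite.card_eq_zero_iff] at h1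
      exact ⟨fun k => 0, ⟨fun k => h1.elim k, fun k => h1.elim k⟩, fun k => h1.elim k,
        fun h => absurd h hfd⟩
  choose f hfo hfm hfs using key
  have hcoe : ∀ k t (h : lam k = t), f (lam k) ⟨k, rfl⟩ = f t ⟨k, h⟩ := by
    rintro k t rfl; rfl
  refine ⟨fun k => f (lam k) ⟨k, rfl⟩, ⟨fun k => (hfo (lam k)).1 _, fun k l hkl => ?_⟩,
    fun k => hfm _ _, fun t ht => (hfs t ht).trans (Submodule.span_mono ?_)⟩
  · by_cases h : lam k = lam l
    · simp only
      rw [hcoe k (lam l) h]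
      exact (hfo (lam l)).2 (fun hh => hkl (congrArg Subtype.val hh))
    · exact eig_orth A hs i D _ _ h _ _ (hfm _ _) (hfm _ _)
  · rintro _ ⟨⟨k, hk⟩, rfl⟩
    exact ⟨k, hk, hcoe k t hk⟩


theorem friedlander_core {K : Type*} [NormedAddCommGroup K] [InnerProductSpace ℂ K]
    [CompleteSpace V] (A : V →ₗ[ℂ] V →ₗ⋆[ℂ] ℂ) (hs : ∀ u v, A v u = conj (A u v))
    (hp : ∀ u, 0 ≤ (A u u).re) (M : ℝ) (hM : ∀ u v, ‖A u v‖ ≤ M * ‖u‖ * ‖v‖)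
    (i : V →L[ℂ] H) (hinj : Function.Injective ⇑i) (hi : IsCompactOperator ⇑i)
    (j : V →L[ℂ] K)
    (ω μ : ℝ) (hω : 0 < ω) (hμ : 0 < μ)
    (hell : ∀ u, μ * ‖u‖ ^ 2 ≤ (A u u).re + ω * ‖i u‖ ^ 2)
    (D : Submodule ℂ V) (hDj : ∀ u, u ∈ D ↔ j u = 0)
    (hI : ∀ (u : V) (t : ℝ), j u = 0 → u ∈ eigS A i ⊤ t → u = 0)
    (hII : ∀ lam : ℝ, 0 < lam → ∀ P : Submodule ℂ K, FiniteDimensional ℂ P →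
      ∃ (u : V) (f : K), j u ∉ P ∧ (∀ v, A u v - lam * gramForm i u v = ⟪j v, f⟫) ∧ ⟪j u, f⟫ = 0)
    (lamN lamD : ℕ → ℝ) (hmN : Monotone lamN) (hmD : Monotone lamD)
    (hfN : ∀ t : ℝ, {n : ℕ | lamN n = t}.Finite)
    (hcN : ∀ t : ℝ, Nat.card {n : ℕ | lamN n = t} = Module.finrank ℂ (eigS A i ⊤ t))
    (hfD : ∀ t : ℝ, {n : ℕ | lamD n = t}.Finite)
    (hcD : ∀ t : ℝ, Nat.card {n : ℕ | lamD n = t} = Module.finrank ℂ (eigS A i D t)) (n : ℕ) :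
    lamN (n + 1) < lamD n := by
  obtain ⟨eN, hNo, hNm, hNs⟩ := eig_basis A hs i hinj ⊤ lamN hfN hcN
  obtain ⟨eD, hDo, hDm, -⟩ := eig_basis A hs i hinj D lamD hfD hcD
  set lam := lamD n with hlam
  have hfd := fun t => eigS_finite A i hi ω μ hω hμ hell t
  have hself : ∀ u, (A u u).im = 0 := fun u => conj_eq_iff_im.mp (hs u u).symm
  have hpos : 0 < lam := by
    have hn := hDm n
    have h1 : ‖i (eD n)‖ = 1 := hDo.1 n
    have h2 : (A (eD n) (eD n)).re = lam := by
      rw [hn.2 _ hn.1, re_ofReal_mul, gramForm_self_re, h1]; simp [hlam]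
    rcases (h2 ▸ hp (eD n) : 0 ≤ lam).lt_or_eq with h | h
    · exact h
    · exfalso
      have h3 : A (eD n) (eD n) = 0 := Complex.ext (by rw [h2, ← h]; rfl) (hself _)
      have h4 : eD n = 0 := hI (eD n) 0 ((hDj _).1 hn.1)
        ⟨trivial, fun v _ => by
          rw [degenerate_cs A hs (eD n) v h3 (fun c => hp _)]; simp⟩
      rw [h4] at h1
      simp at h1
  by_contra hcon
  rw [not_lt] at hcon
  set L := (hfN lam).toFinset with hL
  set S : Finset ℕ := Finset.range (n + 1) ∪ L with hS
  have hSmem : ∀ k, lamN k ≤ lam → k ∈ S := by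
    intro k hk
    rw [hS, Finset.mem_union]
    rcases hk.lt_or_eq with h | h
    · left
      rw [Finset.mem_range]
      by_contra h'
      have := hmN (not_lt.mp h')
      linarith
    · right; simpa [hL] using h
  have := hfd lam
  obtain ⟨u, f, hu, huf, huu⟩ := hII lam hpos ((eigS A i ⊤ lam).map (j : V →ₗ[ℂ] K)) inferInstance
  let T : ((Fin (n + 1) → ℂ) × ℂ × (L → ℂ)) →ₗ[ℂ] V :=
    (Fintype.linearCombination ℂ (fun k : Fin (n + 1) => eD k)) ∘ₗ LinearMap.fst ℂ _ _ +
    (LinearMap.toSpanSingleton ℂ V u) ∘ₗ LinearMap.fst ℂ _ _ ∘ₗ LinearMap.snd ℂ _ _ +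
    (Fintype.linearCombination ℂ (fun k : L => eN k)) ∘ₗ LinearMap.snd ℂ _ _ ∘ₗ LinearMap.snd ℂ _ _
  let P : V →ₗ[ℂ] (S → ℂ) :=
    LinearMap.pi fun k => ((innerSL ℂ (i (eN k))).comp i : V →ₗ[ℂ] ℂ)
  have hrank : Module.finrank ℂ (S → ℂ) <
      Module.finrank ℂ ((Fin (n + 1) → ℂ) × ℂ × (L → ℂ)) := by
    have := Finset.card_union_le (Finset.range (n + 1)) L
    simp only [Module.finrank_prod, Module.finrank_fintype_fun_eq_card, Module.finrank_self,
      Fintype.card_fin, Fintype.card_coe]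
    rw [Finset.card_range, ← hS] at this
    omega
  have hker := LinearMap.ker_ne_bot_of_finrank_lt (f := P ∘ₗ T) hrank
  obtain ⟨⟨c, α, d⟩, hx, hx0⟩ := (Submodule.ne_bot_iff _).1 hker
  set p : V := ∑ k, c k • eD (k : Fin (n + 1)) with hpdef
  set q : V := ∑ k, d k • eN (k : L) with hqdef
  set w : V := p + α • u + q with hwdef
  have hTw : T (c, α, d) = w := by
    simp [T, Fintype.linearCombination_apply, hwdef, hpdef, hqdef]
  have hpD : p ∈ D := Submodule.sum_mem _ fun k _ => D.smul_mem _ (hDm k).1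
  have hjp : j p = 0 := (hDj p).1 hpD
  have hq : q ∈ eigS A i ⊤ lam := by
    refine Submodule.sum_mem _ fun k _ => Submodule.smul_mem _ _ ?_
    have h1 := hNm k
    have h2 : lamN k = lam := (hfN lam).mem_toFinset.1 k.2
    rwa [h2] at h1
  have hw0 : w ≠ 0 := by
    intro hw
    have hα : α = 0 := by
      by_contra hα
      apply hu
      have h1 : j w = 0 := by rw [hw, map_zero]
      rw [hwdef, map_add, map_add, hjp, zero_add, map_smul] at h1
      refine ⟨(-α⁻¹) • q, Submodule.smul_mem _ _ hq, ?_⟩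
      have h2 : j q = -(α • j u) := by rw [eq_neg_iff_add_eq_zero, add_comm]; exact h1
      simp [h2, smul_smul, hα]
    have hw' : p + q = 0 := by rw [← hw, hwdef, hα]; simp
    have hq0 : q = 0 := by
      refine hI q lam ?_ hq
      have h1 : j (p + q) = 0 := by rw [hw', map_zero]
      rwa [map_add, hjp, zero_add] at h1
    have hp0 : p = 0 := by rwa [hq0, add_zero] at hw'
    apply hx0
    have hc : c = 0 := by
      have h1 := (hDo.comp (fun k : Fin (n + 1) => (k : ℕ)) Fin.val_injective).linearIndependent
      rw [Fintype.linearIndependent_iff] at h1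
      funext k
      refine h1 c ?_ k
      have := congrArg i hp0
      rw [hpdef, map_sum, map_zero] at this
      simpa using this
    have hd : d = 0 := by
      have h1 := (hNo.comp (fun k : L => (k : ℕ)) Subtype.val_injective).linearIndependent
      rw [Fintype.linearIndependent_iff] at h1
      funext k
      refine h1 d ?_ k
      have := congrArg i hq0
      rw [hqdef, map_sum, map_zero] at this
      simpa using this
    rw [hc, hα, hd]; rfl
  -- the form on `p`
  have hpp : (A p p).re ≤ lam * ‖i p‖ ^ 2 := by
    have hcomp := hDo.comp (fun k : Fin (n + 1) => (k : ℕ)) Fin.val_injective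
    have hip : i p = ∑ k, c k • ((fun k => i (eD k)) ∘ (fun k : Fin (n + 1) => (k : ℕ))) k := by
      rw [hpdef, map_sum]; simp
    have hg : ∀ k : Fin (n + 1), gramForm i (eD k) p = conj (c k) := by
      intro k
      rw [gramForm_apply, hip]
      exact hcomp.inner_left_fintype c k
    have h1 : A p p = ∑ k : Fin (n + 1), c k * (lamD k * conj (c k)) := by
      have h0 : A p = ∑ k : Fin (n + 1), c k • A (eD k) := by
        rw [hpdef, map_sum]; simp only [map_smul]
      rw [h0, LinearMap.sum_apply]
      refine Finset.sum_congr rfl fun k _ => ?_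
      rw [LinearMap.smul_apply, smul_eq_mul, (hDm k).2 p hpD, hg]
    have h2 : gramForm i p p = ∑ k : Fin (n + 1), c k * conj (c k) := by
      have h0 : gramForm i p = ∑ k : Fin (n + 1), c k • gramForm i (eD k) := by
        rw [hpdef, map_sum]; simp only [map_smul]
      rw [h0, LinearMap.sum_apply]
      refine Finset.sum_congr rfl fun k _ => ?_
      rw [LinearMap.smul_apply, smul_eq_mul, hg]
    rw [← gramForm_self_re, h1, h2, re_sum, re_sum, Finset.mul_sum]
    refine Finset.sum_le_sum fun k _ => ?_
    have h3 : lamD k ≤ lam := hmD (Nat.lt_succ_iff.mp k.2)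
    have h4 : c k * (lamD k * conj (c k)) = ((lamD k * normSq (c k) : ℝ) : ℂ) := by
      rw [mul_left_comm, mul_conj]; push_cast; rfl
    rw [h4, mul_conj, ofReal_re, ofReal_re]
    exact mul_le_mul_of_nonneg_right h3 (normSq_nonneg _)
  have hww : (A w w).re ≤ lam * ‖i w‖ ^ 2 := by
    set Q := A - (lam : ℂ) • gramForm i with hQ
    have hQa : ∀ x y, Q x y = A x y - lam * gramForm i x y := by intro x y; simp [hQ]
    have hQs : ∀ x y, Q y x = conj (Q x y) := by
      intro x y; simp [hQa, gramForm_apply, hs x y]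
    have hre : ∀ x, (Q x x).re = (A x x).re - lam * ‖i x‖ ^ 2 := by
      intro x; rw [hQa, sub_re, re_ofReal_mul, gramForm_self_re]
    have q1 : ∀ v, Q q v = 0 := by intro v; rw [hQa, hq.2 v trivial, sub_self]
    have q2 : ∀ v, Q v q = 0 := by intro v; rw [hQs q v, q1, map_zero]
    have u1 : Q u p = 0 := by rw [hQa, huf, hjp, inner_zero_left]
    have u2 : Q p u = 0 := by rw [hQs u p, u1, map_zero]
    have u3 : Q u u = 0 := by rw [hQa, huf, huu]
    have h1 : Q w w = Q p p := by
      rw [hwdef]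
      simp only [map_add, LinearMap.add_apply, LinearMap.map_smulₛₗ, LinearMap.smul_apply, q1, q2,
        u1, u2, u3, smul_zero, add_zero]
    have h2 := hre w
    rw [h1, hre p] at h2
    linarith
  -- the orthogonal complement
  let F : Submodule ℂ V := LinearMap.ker P
  have hFm : ∀ v, v ∈ F ↔ ∀ k ∈ S, ⟪i (eN k), i v⟫ = 0 := by
    intro v
    simp [F, P, funext_iff]
  have hFc : IsClosed (F : Set V) := by
    have h1 : (F : Set V) = ⋂ k ∈ S, {v | ⟪i (eN k), i v⟫ = 0} := by
      ext v
      simp only [SetLike.mem_coe, hFm, Set.mem_iInter, Set.mem_ofPred_eq]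
    rw [h1]
    refine isClosed_biInter fun k _ => isClosed_eq ?_ continuous_const
    exact continuous_const.inner i.continuous
  have hwF : w ∈ F := by
    have h1 : P (T (c, α, d)) = 0 := hx
    rw [hTw] at h1
    exact h1
  obtain ⟨t, htl, z, hz, hz0⟩ := min_eig A hs hp M hM i hinj hi ω μ hω hμ hell F hFc w hwF hw0
    lam hww
  have hzF := (hFm z).1 hz.1
  have hzN : z ∈ eigS A i ⊤ t := by
    refine ⟨trivial, fun v _ => ?_⟩
    set y : V := ∑ k ∈ S, ⟪i (eN k), i v⟫ • eN k with hy
    have hvF : v - y ∈ F := by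
      rw [hFm]
      intro k hk
      have h1 : i y = ∑ k ∈ S, ⟪i (eN k), i v⟫ • (fun k => i (eN k)) k := by
        rw [hy, map_sum]; simp
      rw [map_sub, inner_sub_right, h1, hNo.inner_right_sum _ hk, sub_self]
    have h1 : ∀ k ∈ S, gramForm i z (eN k) = 0 := fun k hk => hzF k hk
    have h2 : ∀ k ∈ S, A z (eN k) = 0 := by
      intro k hk
      rw [hs (eN k) z, (hNm k).2 z trivial, gramForm_apply, map_mul, inner_conj_symm, hzF k hk,
        mul_zero]
    have h3 : A z y = 0 := by
      rw [hy, map_sum]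
      refine Finset.sum_eq_zero fun k hk => ?_
      rw [LinearMap.map_smulₛₗ, h2 k hk, smul_zero]
    have h4 : gramForm i z y = 0 := by
      rw [hy, map_sum]
      refine Finset.sum_eq_zero fun k hk => ?_
      rw [LinearMap.map_smulₛₗ, h1 k hk, smul_zero]
    have h5 := hz.2 _ hvF
    rwa [map_sub, map_sub, h3, h4, sub_zero, sub_zero] at h5
  have hzs := hNs t (hfd t) hzN
  have horth : ∀ x ∈ Submodule.span ℂ (eN '' {k | lamN k = t}), ⟪i x, i z⟫ = 0 := by
    intro x hx
    induction hx using Submodule.span_induction with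
    | mem x h =>
      obtain ⟨k, hk, rfl⟩ := h
      exact hzF k (hSmem k (le_of_eq_of_le hk htl))
    | zero => simp
    | add x y _ _ hx hy => rw [map_add, inner_add_left, hx, hy, add_zero]
    | smul c x _ hx => rw [map_smul, inner_smul_left, hx, mul_zero]
  have h0 := horth z hzs
  rw [inner_self_eq_zero] at h0
  exact hz0 (hinj (by rw [h0, map_zero]))


/-- The sesquilinear form as a bundled map. -/
def bundleForm (a : V → V → ℂ) (h : IsSesqui a) : V →ₗ[ℂ] V →ₗ⋆[ℂ] ℂ :=
  LinearMap.mk₂'ₛₗ (RingHom.id ℂ) (starRingEnd ℂ) a h.1 h.2.2.1 h.2.1 h.2.2.2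

theorem mem_opGraph (a : V → V → ℂ) (h : IsSesqui a) (i : V →L[ℂ] H) (D : Submodule ℂ V)
    (t : ℝ) (u : V) (hu : u ∈ eigS (bundleForm a h) i D t) :
    (i u, (t : ℂ) • i u) ∈ OpGraphOf a i (D : Set V) := by
  refine ⟨u, hu.1, rfl, subset_closure ⟨(t : ℂ) • u, D.smul_mem _ hu.1, by simp⟩, fun v hv => ?_⟩
  rw [inner_smul_right]
  exact hu.2 v hv

theorem eigMult_eq (a : V → V → ℂ) (h : IsSesqui a) (i : V →L[ℂ] H)
    (hinj : Function.Injective ⇑i) (D : Submodule ℂ V) (t : ℝ) :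
    eigMult (OpGraphOf a i (D : Set V)) t = Module.finrank ℂ (eigS (bundleForm a h) i D t) := by
  have h1 : {x : H | (x, (t : ℂ) • x) ∈ OpGraphOf a i (D : Set V)} =
      ((eigS (bundleForm a h) i D t).map (i : V →ₗ[ℂ] H) : Set H) := by
    ext x
    constructor
    · rintro ⟨u, hu, hx, -, hv⟩
      simp only at hx hv
      refine ⟨u, ⟨hu, fun v hvD => ?_⟩, hx.symm⟩
      have := hv v hvD
      rw [hx, inner_smul_right] at this
      exact this
    · rintro ⟨u, hu, rfl⟩
      exact mem_opGraph a h i D t u hu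
  rw [eigMult, h1, Submodule.span_eq]
  exact ((eigS (bundleForm a h) i D t).equivMapOfInjective (i : V →ₗ[ℂ] H) hinj).finrank_eq.symm

end Proof

/-- Theorem 2.2, abstract Friedlander comparison theorem.
Let `V`, `H`, `K` be Hilbert spaces, `i : V → H` a compact injective embedding,
`j : V → K` a compact linear map and `a` a positive symmetric continuous `i`-elliptic
sesquilinear form.  Let `V_D = ker j`, let `A^N` be the self-adjoint operator in the closure
of `V` in `H` associated with `a` and `A^D` the self-adjoint operator in the closure of
`V_D` in `H` associated with `a|_{V_D × V_D}`.  For `λ ∈ ℝ` let `N_λ` be the self-adjoint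
graph associated with `(b_λ, j)`, where `b_λ(u,v) = a(u,v) - λ (u,v)_H`.  Suppose that
(I) `A^N` has no eigenvector in `V_D` and (II) for all `λ > 0` the span of
`{φ ∈ D(N_λ) : (N_λ° φ, φ)_K = 0}` is infinite dimensional.  If `lamN`, `lamD` are the
eigenvalues of `A^N` and `A^D` repeated with multiplicity, then `lamN (n+1) < lamD n`
for all `n`. -/
theorem statement1
    {V H K : Type*}
    [NormedAddCommGroup V] [InnerProductSpace ℂ V] [CompleteSpace V]
    [NormedAddCommGroup H] [InnerProductSpace ℂ H] [CompleteSpace H]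
    [NormedAddCommGroup K] [InnerProductSpace ℂ K] [CompleteSpace K]
    (i : V →L[ℂ] H) (hinj : Function.Injective ⇑i) (hicpt : IsCompactOperator ⇑i)
    (j : V →L[ℂ] K) (hjcpt : IsCompactOperator ⇑j)
    (a : V → V → ℂ)
    (hsesq : IsSesqui a) (hpos : IsPositiveForm a) (hsymm : IsSymmForm a)
    (hcont : IsContinuousForm a) (hell : IsElliptic a ⇑i)
    (hI : ∀ (u : V) (t : ℂ), j u = 0 → (i u, t • i u) ∈ OpGraphOf a i Set.univ → u = 0)
    (hII : ∀ lam : ℝ, 0 < lam →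
      InfiniteNullSpan (GraphOf (fun u v => a u v - (lam : ℂ) * @inner ℂ _ _ (i v) (i u)) j))
    (lamN lamD : ℕ → ℝ)
    (hN : IsEigSeq (OpGraphOf a i Set.univ) lamN)
    (hD : IsEigSeq (OpGraphOf a i {u : V | j u = 0}) lamD) :
    ∀ n : ℕ, lamN (n + 1) < lamD n := by
  obtain ⟨M, -, hM⟩ := hcont
  obtain ⟨ω, μ, hω, hμ, hell⟩ := hell
  obtain ⟨hmN, hfN, hcN⟩ := hN
  obtain ⟨hmD, hfD, hcD⟩ := hD
  intro n
  refine friedlander_core (bundleForm a hsesq) hsymm (fun u => (hpos u).1) M hM i hinj hicpt j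
    ω μ hω hμ hell (LinearMap.ker (j : V →ₗ[ℂ] K)) (fun u => Iff.rfl) ?_ ?_ lamN lamD hmN hmD
    hfN ?_ hfD ?_ n
  · intro u t hju hu
    exact hI u t hju (mem_opGraph a hsesq i ⊤ t u hu)
  · intro lam hlam P hP
    by_contra hcon
    push Not at hcon
    apply hII lam hlam
    have hle : Submodule.span ℂ {φ : K | ∃ f : K, (φ, f) ∈ SingleValuedPartG (GraphOf
        (fun u v => a u v - (lam : ℂ) * @inner ℂ _ _ (i v) (i u)) j) ∧ ⟪φ, f⟫ = 0} ≤ P := by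
      rw [Submodule.span_le]
      rintro φ ⟨f, ⟨⟨u, hφ, hv⟩, -⟩, h0⟩
      simp only at hφ hv
      subst hφ
      by_contra hn
      exact hcon u f hn hv h0
    exact Submodule.finiteDimensional_of_le hle
  · intro t
    rw [hcN t]
    exact eigMult_eq a hsesq i hinj ⊤ t
  · intro t
    rw [hcD t]
    exact eigMult_eq a hsesq i hinj (LinearMap.ker (j : V →ₗ[ℂ] K)) t
end
end

section
/- Let V, H, K be Hilbert spaces with compact inclusion i : V → H and compact linear j : V → K, and 𝔞 : V × V → ℂ a positive symmetric continuous i-elliptic sesquilinear form with V_D = ker j. For μ ∈ ℝ let A_μ be the self-adjoint graph associated with (𝔞_μ, i), where 𝔞_μ(u,v) = 𝔞(u,v) − μ(j(u), j(v))_K, with eigenvalues λ₁(μ) ≤ λ₂(μ) ≤ … repeated with multiplicity, and let λ₁^D ≤ λ₂^D ≤ … be the eigenvalues of the self-adjoint operator A^D associated with 𝔞 restricted to V_D × V_D, repeated with multiplicity. Then for every n ∈ ℕ, λ_n(μ) → λ_n^D as μ → −∞. -/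
/-!
Abstract framework for forms, graphs (linear relations) and their spectra,
following Arendt--ter Elst style form methods.
-/

noncomputable section
open Complex Filter Topology ComplexConjugate

local notation "⟪" x ", " y "⟫" => @inner ℂ _ _ x y

section Aux

variable {V H : Type*}
variable [NormedAddCommGroup V] [InnerProductSpace ℂ V]
variable [NormedAddCommGroup H] [InnerProductSpace ℂ H]

lemma aux_ultra_lim {X α : Type*} [TopologicalSpace X] {s : Set X} (hs : IsCompact s)
    (U : Ultrafilter α) (f : α → X) (h : ∀ᶠ x in (U : Filter α), f x ∈ s) :
    ∃ y ∈ s, Tendsto f U (𝓝 y) := by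
  obtain ⟨y, hy, hle⟩ := hs.ultrafilter_le_nhds' (U.map f) (Ultrafilter.mem_map.2 h)
  exact ⟨y, hy, hle⟩

lemma aux_weak_lim [CompleteSpace V] {α : Type*} (U : Ultrafilter α) (u : α → V) (C : ℝ)
    (h : ∀ᶠ x in (U : Filter α), ‖u x‖ ≤ C) :
    ∃ w : V, ∀ φ : V →L[ℂ] ℂ, Tendsto (fun x => φ (u x)) U (𝓝 (φ w)) := by
  obtain ⟨y, -, hy⟩ := aux_ultra_lim (WeakDual.isCompact_closedBall (0 : StrongDual ℂ V) C) U
    (fun x => StrongDual.toWeakDual (InnerProductSpace.toDual ℂ V (u x))) (by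
      filter_upwards [h] with x hx
      simpa using hx)
  let w := (InnerProductSpace.toDual ℂ V).symm (WeakDual.toStrongDual y)
  refine ⟨w, fun φ => ?_⟩
  let g := (InnerProductSpace.toDual ℂ V).symm φ
  have h1 : Tendsto (fun x => ⟪u x, g⟫) U (𝓝 (y g)) := by
    have := ((WeakDual.eval_continuous g).tendsto y).comp hy
    exact this
  have h2 : y g = ⟪w, g⟫ := by
    simp only [w]
    rw [InnerProductSpace.toDual_symm_apply]
    rfl
  have h3 : ∀ x, φ x = conj ⟪x, g⟫ := by
    intro x
    rw [inner_conj_symm]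
    simp only [g]
    rw [InnerProductSpace.toDual_symm_apply]
  rw [h2] at h1
  simp only [h3]
  exact (Complex.continuous_conj.tendsto _).comp h1

lemma aux_strong_lim {i : V →L[ℂ] H} (hi : IsCompactOperator ⇑i) {α : Type*} (U : Ultrafilter α)
    (u : α → V) (C : ℝ) (h : ∀ᶠ x in (U : Filter α), ‖u x‖ ≤ C) (w : V)
    (hw : ∀ φ : V →L[ℂ] ℂ, Tendsto (fun x => φ (u x)) U (𝓝 (φ w))) :
    Tendsto (fun x => i (u x)) U (𝓝 (i w)) := by
  obtain ⟨y, -, hy⟩ := aux_ultra_lim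
    (IsCompactOperator.isCompact_closure_image_closedBall (f := (i : V →ₗ[ℂ] H)) hi C) U
    (fun x => i (u x)) (by
      filter_upwards [h] with x hx
      exact subset_closure ⟨u x, by simpa using hx, rfl⟩)
  have : y = i w := by
    refine ext_inner_left ℂ fun v => ?_
    have h1 : Tendsto (fun x => ⟪v, i (u x)⟫) U (𝓝 ⟪v, y⟫) := tendsto_const_nhds.inner hy
    have h2 : Tendsto (fun x => ⟪v, i (u x)⟫) U (𝓝 ⟪v, i w⟫) :=
      hw ((innerSL ℂ v).comp i)
    exact tendsto_nhds_unique h1 h2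
  rwa [← this]

/-- functional `b · v`. -/
lemma aux_functional {b : V → V → ℂ} (hs : IsSesqui b) (hc : IsContinuousForm b) (v : V) :
    ∃ φ : V →L[ℂ] ℂ, ∀ u, φ u = b u v := by
  obtain ⟨M, hM, hb⟩ := hc
  refine ⟨LinearMap.mkContinuous
    { toFun := fun u => b u v, map_add' := fun x y => hs.1 x y v,
      map_smul' := fun c x => by simpa using hs.2.2.1 c x v } (M * ‖v‖) ?_, fun u => rfl⟩
  intro u
  have := hb u v
  simp only [LinearMap.coe_mk, AddHom.coe_mk]
  linarith

lemma aux_sum_left {b : V → V → ℂ} (hs : IsSesqui b) {ι : Type*} (s : Finset ι) (c : ι → ℂ)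
    (f : ι → V) (v : V) : b (∑ k ∈ s, c k • f k) v = ∑ k ∈ s, c k * b (f k) v := by
  classical
  induction s using Finset.induction_on with
  | empty => simpa using hs.2.2.1 0 0 v
  | insert k s hk ih => rw [Finset.sum_insert hk, Finset.sum_insert hk, hs.1, hs.2.2.1, ih]

lemma aux_sum_right {b : V → V → ℂ} (hs : IsSesqui b) {ι : Type*} (s : Finset ι) (c : ι → ℂ)
    (f : ι → V) (v : V) : b v (∑ k ∈ s, c k • f k) = ∑ k ∈ s, conj (c k) * b v (f k) := by
  classical
  induction s using Finset.induction_on with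
  | empty => simpa using hs.2.2.2 0 v 0
  | insert k s hk ih => rw [Finset.sum_insert hk, Finset.sum_insert hk, hs.2.1, hs.2.2.2, ih]

/-- Eigenspace of the form problem. -/
def auxEig (i : V →L[ℂ] H) (b : V → V → ℂ) (hs : IsSesqui b) (t : ℝ) : Submodule ℂ V where
  carrier := {u | ∀ v, b u v = t * ⟪i v, i u⟫}
  add_mem' := by
    intro x y hx hy v
    rw [hs.1, hx v, hy v, map_add, inner_add_right, mul_add]
  zero_mem' := by
    intro v
    have := hs.2.2.1 0 0 v
    simp at this
    simp [this]
  smul_mem' := by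
    intro c x hx v
    rw [hs.2.2.1, hx v, map_smul, inner_smul_right]
    ring

lemma aux_eig_bound (i : V →L[ℂ] H) (b : V → V → ℂ) (t : ℝ) {ω δ : ℝ}
    (hell : ∀ u, δ * ‖u‖ ^ 2 ≤ (b u u).re + ω * ‖i u‖ ^ 2) (u : V)
    (hu : ∀ v, b u v = t * ⟪i v, i u⟫) : δ * ‖u‖ ^ 2 ≤ (t + ω) * ‖i u‖ ^ 2 := by
  have h1 := hell u
  have h2 : (b u u).re = t * ‖i u‖ ^ 2 := by
    rw [hu u, inner_self_eq_norm_sq_to_K, Complex.re_ofReal_mul]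
    congr 1
    norm_cast
  nlinarith

lemma aux_finite [CompleteSpace V] (i : V →L[ℂ] H) (hi : IsCompactOperator ⇑i)
    (b : V → V → ℂ) (hs : IsSesqui b) (hc : IsContinuousForm b) (hell : IsElliptic b ⇑i) (t : ℝ) :
    FiniteDimensional ℂ (auxEig i b hs t) := by
  obtain ⟨ω, δ, hω, hδ, hell⟩ := hell
  refine FiniteDimensional.of_isCompact_closedBall (r := 1) ℂ one_pos (c := 0) ?_
  rw [isCompact_iff_ultrafilter_le_nhds']
  intro U hU
  have hb : ∀ᶠ x : auxEig i b hs t in U, ‖(x : V)‖ ≤ 1 := by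
    filter_upwards [hU] with x hx
    simpa using hx
  obtain ⟨w, hw⟩ := aux_weak_lim U (fun x : auxEig i b hs t => (x : V)) 1 hb
  have hiw := aux_strong_lim hi U _ 1 hb w hw
  have hwE : w ∈ auxEig i b hs t := by
    intro v
    obtain ⟨φ, hφ⟩ := aux_functional hs hc v
    have h1 := hw φ
    have h2 : Tendsto (fun x : auxEig i b hs t => (t : ℂ) * ⟪i v, i x⟫) U
        (𝓝 (t * ⟪i v, i w⟫)) := (tendsto_const_nhds.inner hiw).const_mul _
    rw [← hφ]
    refine tendsto_nhds_unique h1 (h2.congr fun x => ?_)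
    rw [hφ]
    exact (x.2 v).symm
  have hlim : Tendsto (fun x : auxEig i b hs t => ‖x - ⟨w, hwE⟩‖) U (𝓝 0) := by
    have h1 : Tendsto (fun x : auxEig i b hs t => (t + ω) * ‖i x - i w‖ ^ 2 / δ) U (𝓝 0) := by
      have := ((((hiw.sub_const (i w)).norm).pow 2).const_mul (t + ω)).div_const δ
      simpa using this
    have h2 : Tendsto (fun x : auxEig i b hs t => ‖x - ⟨w, hwE⟩‖ ^ 2) U (𝓝 0) := by
      refine squeeze_zero (fun _ => by positivity) (fun x => ?_) h1
      rw [le_div_iff₀ hδ]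
      have := aux_eig_bound i b t hell _ (x - ⟨w, hwE⟩ : auxEig i b hs t).2
      simp only [AddSubgroupClass.coe_sub, map_sub] at this
      rw [mul_comm]
      exact this
    have := h2.sqrt
    simpa using this
  have hle : (U : Filter (auxEig i b hs t)) ≤ 𝓝 ⟨w, hwE⟩ := by
    have := tendsto_iff_norm_sub_tendsto_zero.2 hlim
    exact this
  exact ⟨⟨w, hwE⟩, Metric.isClosed_closedBall.mem_of_tendsto (f := id) hle hU, hle⟩

lemma aux_basis [CompleteSpace V] (i : V →L[ℂ] H) (hinj : Function.Injective ⇑i)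
    (hi : IsCompactOperator ⇑i)
    (b : V → V → ℂ) (hs : IsSesqui b) (hc : IsContinuousForm b) (hsymm : IsSymmForm b)
    (hell : IsElliptic b ⇑i) (lam : ℕ → ℝ) (hfin : ∀ t : ℝ, {n : ℕ | lam n = t}.Finite)
    (hcard : ∀ t : ℝ, Nat.card {n : ℕ | lam n = t} = Module.finrank ℂ (auxEig i b hs t)) :
    ∃ e : ℕ → V, (∀ n, e n ∈ auxEig i b hs (lam n)) ∧ Orthonormal ℂ (fun n => i (e n)) ∧
      ∀ t, ∀ w ∈ auxEig i b hs t, (∀ m, lam m = t → ⟪i (e m), i w⟫ = 0) → i w = 0 := by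
  have key : ∀ t : ℝ, ∃ f : {n : ℕ | lam n = t} → V, (∀ n, f n ∈ auxEig i b hs t) ∧
      Orthonormal ℂ (fun n => i (f n)) ∧
      ∀ w ∈ auxEig i b hs t, (∀ m, ⟪i (f m), i w⟫ = 0) → i w = 0 := by
    intro t
    have := aux_finite i hi b hs hc hell t
    have : Finite {n : ℕ | lam n = t} := hfin t
    let G := (auxEig i b hs t).map (i : V →ₗ[ℂ] H)
    have hG : Module.finrank ℂ G = Nat.card {n : ℕ | lam n = t} := by
      rw [hcard t]
      exact (LinearEquiv.finrank_eq (Submodule.equivMapOfInjective (i : V →ₗ[ℂ] H) hinj _)).symm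
    let B := stdOrthonormalBasis ℂ G
    let E : {n : ℕ | lam n = t} ≃ Fin (Module.finrank ℂ G) := Finite.equivFinOfCardEq hG.symm
    have hB : ∀ n, ∃ u ∈ auxEig i b hs t, i u = (B (E n) : H) := fun n => (B (E n)).2
    choose f hf1 hf2 using hB
    refine ⟨f, hf1, ?_, ?_⟩
    · simp only [hf2]
      have h1 := B.orthonormal.comp E E.injective
      exact h1.comp_linearIsometry G.subtypeₗᵢ
    · intro w hw h0
      let x : G := ⟨i w, w, hw, rfl⟩
      have hx : x = 0 := by
        rw [← B.sum_repr x]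
        refine Finset.sum_eq_zero fun k _ => ?_
        have h2 := h0 (E.symm k)
        rw [hf2, Equiv.apply_symm_apply] at h2
        rw [B.repr_apply_apply]
        have : ⟪B k, x⟫ = 0 := h2
        rw [this, zero_smul]
      exact congrArg Subtype.val hx
  choose f hf1 hf2 hf3 using key
  have hcast : ∀ m t (h : lam m = t), f (lam m) ⟨m, rfl⟩ = f t ⟨m, h⟩ := by
    rintro m t rfl
    rfl
  refine ⟨fun n => f (lam n) ⟨n, rfl⟩, fun n => hf1 _ _, ?_, ?_⟩
  · constructor
    · intro n
      exact (hf2 (lam n)).1 ⟨n, rfl⟩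
    · intro n m hnm
      simp only
      by_cases h : lam m = lam n
      · rw [hcast m _ h]
        exact (hf2 (lam n)).2 (by simpa using hnm)
      · have h1 := hf1 (lam n) ⟨n, rfl⟩ (f (lam m) ⟨m, rfl⟩)
        have h2 := hf1 (lam m) ⟨m, rfl⟩ (f (lam n) ⟨n, rfl⟩)
        rw [hsymm, h1] at h2
        rw [map_mul, inner_conj_symm, Complex.conj_ofReal] at h2
        have h3 : ((lam n : ℂ) - lam m) * ⟪i (f (lam n) ⟨n, rfl⟩), i (f (lam m) ⟨m, rfl⟩)⟫ = 0 := by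
          rw [sub_mul, h2, sub_self]
        rcases mul_eq_zero.1 h3 with h4 | h4
        · exact absurd (by exact_mod_cast (sub_eq_zero.1 h4).symm) h
        · exact h4
  · intro t w hw h0
    refine hf3 t w hw ?_
    rintro ⟨m, hm⟩
    rw [← hcast m t hm]
    exact h0 m hm

lemma aux_core [CompleteSpace V] (i : V →L[ℂ] H)
    (hi : IsCompactOperator ⇑i)
    (b : V → V → ℂ) (hs : IsSesqui b) (hc : IsContinuousForm b) (hsymm : IsSymmForm b)
    (hpos : IsPositiveForm b)
    (hell : IsElliptic b ⇑i) (lam : ℕ → ℝ) (hmono : Monotone lam)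
    (e : ℕ → V) (he : ∀ n, e n ∈ auxEig i b hs (lam n)) (ho : Orthonormal ℂ (fun n => i (e n)))
    (hcompl : ∀ t, ∀ w ∈ auxEig i b hs t, (∀ m, lam m = t → ⟪i (e m), i w⟫ = 0) → i w = 0)
    (n : ℕ) (u₀ : V) (hu₀ : ∀ k < n, ⟪i (e k), i u₀⟫ = 0) :
    lam n * ‖i u₀‖ ^ 2 ≤ (b u₀ u₀).re := by
  obtain ⟨ω, δ, hω, hδ, hell⟩ := hell
  by_contra! hlt
  let Q : V → ℝ := fun u => (b u u).re
  let S : Set V := {u | (∀ k < n, ⟪i (e k), i u⟫ = 0) ∧ ‖i u‖ = 1}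
  have hsmul : ∀ (c : ℂ) u, Q (c • u) = ‖c‖ ^ 2 * Q u := by
    intro c u
    simp only [Q]
    rw [hs.2.2.1, hs.2.2.2, ← mul_assoc, Complex.mul_conj, Complex.re_ofReal_mul,
      Complex.normSq_eq_norm_sq]
  have hne0 : ‖i u₀‖ ≠ 0 := by
    intro h
    rw [h] at hlt
    have := (hpos u₀).1
    simp at hlt
    linarith
  have hnorm : ∀ u, (∀ k < n, ⟪i (e k), i u⟫ = 0) → ‖i u‖ ≠ 0 →
      (((‖i u‖⁻¹ : ℝ) : ℂ) • u) ∈ S := by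
    intro u hu h
    refine ⟨fun k hk => by rw [map_smul, inner_smul_right, hu k hk, mul_zero], ?_⟩
    rw [map_smul, norm_smul]
    simp [h]
  have hne : (Q '' S).Nonempty := ⟨_, _, hnorm u₀ hu₀ hne0, rfl⟩
  have hbdd : BddBelow (Q '' S) := ⟨0, by
    rintro _ ⟨u, -, rfl⟩
    exact (hpos u).1⟩
  set t := sInf (Q '' S) with ht
  have htle : ∀ u, (∀ k < n, ⟪i (e k), i u⟫ = 0) → t * ‖i u‖ ^ 2 ≤ Q u := by
    intro u hu
    by_cases h : ‖i u‖ = 0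
    · rw [h]
      simpa using (hpos u).1
    · have h1 : t ≤ Q _ := csInf_le hbdd ⟨_, hnorm u hu h, rfl⟩
      rw [hsmul, Complex.norm_real, norm_inv, norm_norm, inv_pow, inv_mul_eq_div,
        le_div_iff₀ (by positivity)] at h1
      exact h1
  have htlam : t < lam n := by
    have h1 := htle u₀ hu₀
    have h2 : t * ‖i u₀‖ ^ 2 < lam n * ‖i u₀‖ ^ 2 := lt_of_le_of_lt h1 hlt
    exact lt_of_mul_lt_mul_right h2 (by positivity)
  obtain ⟨q, -, hq, hqS⟩ := exists_seq_tendsto_sInf hne hbdd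
  choose x hxS hxq using hqS
  let U : Ultrafilter ℕ := hyperfilter ℕ
  have hU : (U : Filter ℕ) ≤ atTop := by
    rw [← Nat.cofinite_eq_atTop]
    exact hyperfilter_le_cofinite
  have hq' : Tendsto q U (𝓝 t) := hq.mono_left hU
  have hbd : ∀ᶠ m in (U : Filter ℕ), ‖x m‖ ≤ Real.sqrt ((t + 1 + ω) / δ) := by
    filter_upwards [hq'.eventually (gt_mem_nhds (lt_add_one t))] with m hm
    apply Real.le_sqrt_of_sq_le
    rw [le_div_iff₀ hδ]
    have h1 := hell (x m)
    have h2 : (b (x m) (x m)).re = q m := hxq m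
    rw [(hxS m).2] at h1
    linarith
  obtain ⟨w, hw⟩ := aux_weak_lim U x _ hbd
  have hiw := aux_strong_lim hi U x _ hbd w hw
  have hw1 : ‖i w‖ = 1 := by
    refine tendsto_nhds_unique hiw.norm ?_
    simp only [(hxS _).2]
    exact tendsto_const_nhds
  have hwM : ∀ k < n, ⟪i (e k), i w⟫ = 0 := by
    intro k hk
    have h1 : Tendsto (fun m => ⟪i (e k), i (x m)⟫) U (𝓝 ⟪i (e k), i w⟫) :=
      tendsto_const_nhds.inner hiw
    refine tendsto_nhds_unique h1 ?_
    simp only [(hxS _).1 k hk]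
    exact tendsto_const_nhds
  have hadd : ∀ u v, Q (u + v) = Q u + 2 * (b u v).re + Q v := by
    intro u v
    simp only [Q]
    rw [hs.1, hs.2.1, hs.2.1, hsymm u v]
    simp
    ring
  have hwQ : Q w ≤ t := by
    obtain ⟨φ, hφ⟩ := aux_functional hs hc w
    have h1 : Tendsto (fun m => 2 * (φ (x m)).re - Q w) U (𝓝 (2 * (φ w).re - Q w)) :=
      (((Complex.continuous_re.tendsto _).comp (hw φ)).const_mul 2).sub_const _
    have h2 := le_of_tendsto_of_tendsto' h1 hq' (fun m => by
      have h3 : 0 ≤ Q (x m + (-1 : ℂ) • w) := (hpos _).1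
      rw [hadd, hsmul, hs.2.2.2, ] at h3
      have h4 : Q (x m) = q m := hxq m
      rw [hφ]
      simp at h3
      linarith)
    rw [hφ] at h2
    simp only [Q] at h2 ⊢
    linarith
  -- stationarity
  have hre : ∀ v, (∀ k < n, ⟪i (e k), i v⟫ = 0) → (b w v).re = t * (⟪i v, i w⟫).re := by
    intro v hv
    have h1 : ∀ s : ℝ, 0 ≤ (Q v - t * ‖i v‖ ^ 2) * (s * s) +
        (2 * ((b w v).re - t * (⟪i v, i w⟫).re)) * s + 0 := by
      intro s
      have h2 := htle (w + (s : ℂ) • v) (fun k hk => by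
        rw [map_add, map_smul, inner_add_right, inner_smul_right, hwM k hk, hv k hk]; simp)
      rw [hadd, hsmul, hs.2.2.2, map_add, map_smul, @norm_add_sq ℂ, norm_smul, hw1,
        Complex.conj_ofReal, Complex.re_ofReal_mul, inner_smul_right] at h2
      simp at h2
      have hsy : (⟪i w, i v⟫).re = (⟪i v, i w⟫).re := inner_re_symm (𝕜 := ℂ) _ _
      rw [hsy] at h2
      rw [mul_pow, sq_abs] at h2
      nlinarith
    have h2 := discrim_le_zero h1
    rw [discrim] at h2
    have h3 : (2 * ((b w v).re - t * (⟪i v, i w⟫).re)) ^ 2 ≤ 0 := by linarith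
    have h4 := pow_eq_zero_iff (two_ne_zero) |>.1 (le_antisymm h3 (sq_nonneg _))
    linarith
  have hM : ∀ v, (∀ k < n, ⟪i (e k), i v⟫ = 0) → b w v = t * ⟪i v, i w⟫ := by
    intro v hv
    apply Complex.ext
    · rw [Complex.re_ofReal_mul]
      exact hre v hv
    · have h1 := hre (Complex.I • v) (fun k hk => by
        rw [map_smul, inner_smul_right, hv k hk, mul_zero])
      rw [hs.2.2.2, map_smul, inner_smul_left] at h1
      simpa using h1
  have hek : ∀ k < n, b w (e k) = t * ⟪i (e k), i w⟫ := by
    intro k hk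
    rw [hsymm (e k) w, he k w, hwM k hk, ← inner_conj_symm, hwM k hk]
    simp
  have hwE : w ∈ auxEig i b hs t := by
    intro v
    let p : V := ∑ k ∈ Finset.range n, ⟪i (e k), i v⟫ • e k
    have hp : ∀ k < n, ⟪i (e k), i (v - p)⟫ = 0 := by
      intro k hk
      simp only [p]
      rw [map_sub, inner_sub_right, map_sum, inner_sum]
      simp only [map_smul, inner_smul_right]
      have := orthonormal_iff_ite.1 ho
      simp only [this]
      simp [hk]
    have h1 := hM _ hp
    have h2 : b w p = t * ⟪i p, i w⟫ := by
      simp only [p]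
      rw [aux_sum_right hs, map_sum, sum_inner, Finset.mul_sum]
      refine Finset.sum_congr rfl fun k hk => ?_
      rw [hek k (Finset.mem_range.1 hk), map_smul, inner_smul_left]
      ring
    have h3 : v = (v - p) + p := by abel
    rw [h3, hs.2.1, h1, h2, map_add, inner_add_left, mul_add]
  have h0 := hcompl t w hwE (fun m hm => hwM m (by
    by_contra! hnm
    have := hmono hnm
    linarith))
  rw [h0] at hw1
  simp at hw1

lemma aux_minmax [CompleteSpace V] (i : V →L[ℂ] H) (hinj : Function.Injective ⇑i)
    (hi : IsCompactOperator ⇑i)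
    (b : V → V → ℂ) (hs : IsSesqui b) (hc : IsContinuousForm b) (hsymm : IsSymmForm b)
    (hpos : IsPositiveForm b)
    (hell : IsElliptic b ⇑i) (lam : ℕ → ℝ) (hmono : Monotone lam)
    (hfin : ∀ t : ℝ, {n : ℕ | lam n = t}.Finite)
    (hcard : ∀ t : ℝ, Nat.card {n : ℕ | lam n = t} = Module.finrank ℂ (auxEig i b hs t))
    (n : ℕ) (f : Fin (n + 1) → V) (t : Fin (n + 1) → ℝ) (c : ℝ) (htc : ∀ k, t k ≤ c)
    (hif : ∀ k l, ⟪i (f k), i (f l)⟫ = if k = l then 1 else 0)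
    (hbf : ∀ k l, b (f k) (f l) = if k = l then (t k : ℂ) else 0) : lam n ≤ c := by
  obtain ⟨e, he, ho, hcompl⟩ := aux_basis i hinj hi b hs hc hsymm hell lam hfin hcard
  let L : (Fin (n + 1) → ℂ) →ₗ[ℂ] (Fin n → ℂ) :=
    LinearMap.pi fun l => ∑ k, ⟪i (e l), i (f k)⟫ • LinearMap.proj k
  have hker : LinearMap.ker L ≠ ⊥ := L.ker_ne_bot_of_finrank_lt (by simp)
  obtain ⟨z, hz, hz0⟩ := Submodule.exists_mem_ne_zero_of_ne_bot hker
  let u : V := ∑ k, z k • f k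
  have hu : ∀ k < n, ⟪i (e k), i u⟫ = 0 := by
    intro k hk
    have h1 := congrFun (LinearMap.mem_ker.1 hz) ⟨k, hk⟩
    simp [L] at h1
    simp only [u, map_sum, inner_sum, map_smul, inner_smul_right]
    rw [← h1]
    exact Finset.sum_congr rfl fun _ _ => mul_comm _ _
  have h1 := aux_core i hi b hs hc hsymm hpos hell lam hmono e he ho hcompl n u hu
  have h2 : ‖i u‖ ^ 2 = ∑ k, ‖z k‖ ^ 2 := by
    have : (⟪i u, i u⟫) = ((∑ k, ‖z k‖ ^ 2 : ℝ) : ℂ) := by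
      simp only [u, map_sum, inner_sum, sum_inner, map_smul, inner_smul_right, inner_smul_left,
        hif]
      simp [Complex.mul_conj, Complex.normSq_eq_norm_sq]
    have h := inner_self_eq_norm_sq (𝕜 := ℂ) (i u)
    rw [this] at h
    rw [← h]
    exact Complex.ofReal_re _
  have h3 : (b u u).re = ∑ k, ‖z k‖ ^ 2 * t k := by
    have : b u u = ((∑ k, ‖z k‖ ^ 2 * t k : ℝ) : ℂ) := by
      simp only [u]
      rw [aux_sum_left hs]
      simp only [aux_sum_right hs, hbf]
      push_cast
      refine Finset.sum_congr rfl fun k _ => ?_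
      simp
      rw [← mul_assoc, Complex.mul_conj, Complex.normSq_eq_norm_sq]
      push_cast
      rfl
    rw [this, Complex.ofReal_re]
  have h4 : 0 < ∑ k, ‖z k‖ ^ 2 := by
    obtain ⟨k, hk⟩ := Function.ne_iff.1 hz0
    refine Finset.sum_pos' (fun _ _ => by positivity) ⟨k, Finset.mem_univ _, ?_⟩
    have : 0 < ‖z k‖ := norm_pos_iff.2 hk
    positivity
  have h5 : ∑ k, ‖z k‖ ^ 2 * t k ≤ c * ∑ k, ‖z k‖ ^ 2 := by
    rw [Finset.mul_sum]
    refine Finset.sum_le_sum fun k _ => ?_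
    rw [mul_comm]
    exact mul_le_mul_of_nonneg_right (htc k) (by positivity)
  rw [h2, h3] at h1
  exact le_of_mul_le_mul_right (h1.trans h5) h4

lemma aux_card (i : V →L[ℂ] H) (hinj : Function.Injective ⇑i) (b : V → V → ℂ) (hs : IsSesqui b)
    (t : ℝ) (S : Set H)
    (hS : ∀ x, x ∈ S ↔ ∃ u : V, x = i u ∧ ∀ v, b u v = t * ⟪i v, i u⟫) :
    Module.finrank ℂ (Submodule.span ℂ S) = Module.finrank ℂ (auxEig i b hs t) := by
  have : S = ((auxEig i b hs t).map (i : V →ₗ[ℂ] H) : Set H) := by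
    ext x
    rw [hS]
    constructor
    · rintro ⟨u, rfl, hu⟩
      exact ⟨u, hu, rfl⟩
    · rintro ⟨u, hu, rfl⟩
      exact ⟨u, rfl, hu⟩
  rw [this, Submodule.span_eq]
  exact (LinearEquiv.finrank_eq (Submodule.equivMapOfInjective (i : V →ₗ[ℂ] H) hinj _)).symm

end Aux

/-- Proposition 2.4.
With `V`, `H`, `K` Hilbert spaces, `i : V → H` a compact injective embedding, `j : V → K`
compact and `a` a positive symmetric continuous `i`-elliptic form, let `A_μ` be the
self-adjoint graph associated with `(a_μ, i)` where `a_μ(u,v) = a(u,v) - μ (j u, j v)_K`,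
with eigenvalues `lam μ 0 ≤ lam μ 1 ≤ …` repeated with multiplicity, and let
`lamD 0 ≤ lamD 1 ≤ …` be the eigenvalues of the self-adjoint operator `A^D` associated with
`a|_{V_D × V_D}` (`V_D = ker j`) repeated with multiplicity.  Then for every `n`,
`lam μ n → lamD n` as `μ → -∞`. -/
theorem statement3
    {V H K : Type*}
    [NormedAddCommGroup V] [InnerProductSpace ℂ V] [CompleteSpace V]
    [NormedAddCommGroup H] [InnerProductSpace ℂ H] [CompleteSpace H]
    [NormedAddCommGroup K] [InnerProductSpace ℂ K] [CompleteSpace K]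
    (i : V →L[ℂ] H) (hinj : Function.Injective ⇑i) (hicpt : IsCompactOperator ⇑i)
    (j : V →L[ℂ] K) (hjcpt : IsCompactOperator ⇑j)
    (a : V → V → ℂ)
    (hsesq : IsSesqui a) (hpos : IsPositiveForm a) (hsymm : IsSymmForm a)
    (hcont : IsContinuousForm a) (hell : IsElliptic a ⇑i)
    (lam : ℝ → ℕ → ℝ) (lamD : ℕ → ℝ)
    (hlam : ∀ μ : ℝ, IsEigSeq
      (GraphOfOn (fun u v => a u v - (μ : ℂ) * @inner ℂ _ _ (j v) (j u)) i Set.univ) (lam μ))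
    (hlamD : IsEigSeq (OpGraphOf a i {u : V | j u = 0}) lamD) :
    ∀ n : ℕ, Tendsto (fun μ : ℝ => lam μ n) atBot (nhds (lamD n)) := by
  
  intro n
  -- the Dirichlet problem
  let W : Submodule ℂ V := LinearMap.ker (j : V →ₗ[ℂ] K)
  have hWmem : ∀ u : V, u ∈ W ↔ j u = 0 := fun u => LinearMap.mem_ker
  have hWclosed : IsClosed (W : Set V) := by
    have : (W : Set V) = j ⁻¹' {0} := by
      ext u
      exact hWmem u
    rw [this]
    exact isClosed_singleton.preimage j.continuous
  have : CompleteSpace W := hWclosed.completeSpace_coe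
  let iD : W →L[ℂ] H := i.comp W.subtypeL
  have hiDinj : Function.Injective ⇑iD := hinj.comp Subtype.val_injective
  have hiDc : IsCompactOperator ⇑iD := hicpt.comp_clm W.subtypeL
  let aD : W → W → ℂ := fun u v => a u v
  have hDs : IsSesqui aD := ⟨fun x y z => hsesq.1 x y z, fun x y z => hsesq.2.1 x y z,
    fun c x y => hsesq.2.2.1 c x y, fun c x y => hsesq.2.2.2 c x y⟩
  have hDc : IsContinuousForm aD := by
    obtain ⟨M, hM, h⟩ := hcont
    exact ⟨M, hM, fun u v => h u v⟩
  have hDsymm : IsSymmForm aD := fun u v => hsymm u v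
  have hDpos : IsPositiveForm aD := fun u => hpos u
  have hDell : IsElliptic aD ⇑iD := by
    obtain ⟨ω, δ, hω, hδ, h⟩ := hell
    exact ⟨ω, δ, hω, hδ, fun u => h u⟩
  obtain ⟨hDmono, hDfin, hDcard⟩ := hlamD
  have hDcard' : ∀ t : ℝ, Nat.card {n : ℕ | lamD n = t} =
      Module.finrank ℂ (auxEig iD aD hDs t) := by
    intro t
    rw [hDcard t, eigMult]
    refine aux_card iD hiDinj aD hDs t _ fun x => ?_
    constructor
    · rintro ⟨u, hu, hx, -, h⟩
      simp only at hx h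
      refine ⟨⟨u, hu⟩, hx, fun v => ?_⟩
      have := h v v.2
      rw [inner_smul_right, hx] at this
      exact this
    · rintro ⟨u, hx, h⟩
      refine ⟨u, u.2, hx, subset_closure ⟨(t : ℂ) • (u : V), W.smul_mem _ u.2, ?_⟩,
        fun v hv => ?_⟩
      · rw [map_smul]
        exact congrArg _ hx.symm
      · have := h ⟨v, hv⟩
        simp only [inner_smul_right, hx]
        exact this
  obtain ⟨eD, heD, hoD, -⟩ := aux_basis iD hiDinj hiDc aD hDs hDc hDsymm hDell lamD hDfin hDcard'
  let am : ℝ → V → V → ℂ := fun μ u v => a u v - (μ : ℂ) * @inner ℂ _ _ (j v) (j u)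
  have hms : ∀ μ, IsSesqui (am μ) := by
    intro μ
    refine ⟨fun x y z => ?_, fun x y z => ?_, fun c x y => ?_, fun c x y => ?_⟩
    · simp only [am, hsesq.1, map_add, inner_add_right]; ring
    · simp only [am, hsesq.2.1, map_add, inner_add_left]; ring
    · simp only [am, hsesq.2.2.1, map_smul, inner_smul_right]; ring
    · simp only [am, hsesq.2.2.2, map_smul, inner_smul_left]; ring
  have hmc : ∀ μ, IsContinuousForm (am μ) := by
    intro μ
    obtain ⟨M, hM, h⟩ := hcont
    refine ⟨M + |μ| * ‖j‖ ^ 2, by positivity, fun u v => ?_⟩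
    have h1 : ‖@inner ℂ _ _ (j v) (j u)‖ ≤ (‖j‖ * ‖v‖) * (‖j‖ * ‖u‖) :=
      (norm_inner_le_norm _ _).trans
        (mul_le_mul (j.le_opNorm v) (j.le_opNorm u) (norm_nonneg _) (by positivity))
    calc ‖am μ u v‖ ≤ ‖a u v‖ + ‖(μ : ℂ) * @inner ℂ _ _ (j v) (j u)‖ := norm_sub_le _ _
      _ ≤ M * ‖u‖ * ‖v‖ + |μ| * ((‖j‖ * ‖v‖) * (‖j‖ * ‖u‖)) := by
          rw [norm_mul, Complex.norm_real, Real.norm_eq_abs]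
          exact add_le_add (h u v) (mul_le_mul_of_nonneg_left h1 (abs_nonneg _))
      _ = _ := by ring
  have hmsymm : ∀ μ, IsSymmForm (am μ) := by
    intro μ u v
    simp only [am, hsymm u v, map_sub, map_mul, Complex.conj_ofReal, inner_conj_symm]
  have hmQ : ∀ μ u, am μ u u = a u u + ((-μ * ‖j u‖ ^ 2 : ℝ) : ℂ) := by
    intro μ u
    simp only [am]
    rw [inner_self_eq_norm_sq_to_K]
    push_cast
    simp only [Complex.coe_algebraMap]
    ring
  have hmQre : ∀ μ u, (am μ u u).re = (a u u).re + -μ * ‖j u‖ ^ 2 := by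
    intro μ u
    rw [hmQ, Complex.add_re, Complex.ofReal_re]
  have hmpos : ∀ μ ≤ 0, IsPositiveForm (am μ) := by
    intro μ hμ u
    constructor
    · rw [hmQre]
      have h1 := (hpos u).1
      have h2 : 0 ≤ -μ * ‖j u‖ ^ 2 := mul_nonneg (by linarith) (by positivity)
      linarith
    · rw [hmQ, Complex.add_im, Complex.ofReal_im, (hpos u).2, add_zero]
  obtain ⟨ω, δ, hω, hδ, hell⟩ := hell
  have hmell : ∀ μ ≤ 0, IsElliptic (am μ) ⇑i := by
    intro μ hμ
    refine ⟨ω, δ, hω, hδ, fun u => ?_⟩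
    rw [hmQre]
    have h1 := hell u
    have h2 : 0 ≤ -μ * ‖j u‖ ^ 2 := mul_nonneg (by linarith) (by positivity)
    linarith
  have hmcard : ∀ μ, ∀ t : ℝ, Nat.card {n : ℕ | lam μ n = t} =
      Module.finrank ℂ (auxEig i (am μ) (hms μ) t) := by
    intro μ t
    rw [(hlam μ).2.2 t, eigMult]
    refine aux_card i hinj (am μ) (hms μ) t _ fun x => ?_
    constructor
    · rintro ⟨u, -, hx, h⟩
      simp only at hx h
      refine ⟨u, hx, fun v => ?_⟩
      have := h v (Set.mem_univ _)
      rw [inner_smul_right, hx] at this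
      exact this
    · rintro ⟨u, hx, h⟩
      refine ⟨u, Set.mem_univ _, hx, fun v _ => ?_⟩
      simp only [inner_smul_right, hx]
      exact h v
  have hex : ∀ μ, ∃ e : ℕ → V, μ ≤ 0 → (∀ n, e n ∈ auxEig i (am μ) (hms μ) (lam μ n)) ∧
      Orthonormal ℂ (fun n => i (e n)) := by
    intro μ
    by_cases hμ : μ ≤ 0
    · obtain ⟨e, h1, h2, -⟩ := aux_basis i hinj hicpt (am μ) (hms μ) (hmc μ) (hmsymm μ)
        (hmell μ hμ) (lam μ) (hlam μ).2.1 (hmcard μ)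
      exact ⟨e, fun _ => ⟨h1, h2⟩⟩
    · exact ⟨fun _ => 0, fun h => absurd h hμ⟩
  choose e he using hex
  have hoD' := orthonormal_iff_ite.1 hoD
  have hup : ∀ μ ≤ 0, ∀ k, lam μ k ≤ lamD k := by
    intro μ hμ k
    refine aux_minmax i hinj hicpt (am μ) (hms μ) (hmc μ) (hmsymm μ) (hmpos μ hμ)
      (hmell μ hμ) (lam μ) (hlam μ).1 (hlam μ).2.1 (hmcard μ) k (fun l => (eD l : V))
      (fun l => lamD l) (lamD k) (fun l => hDmono (Nat.lt_succ_iff.1 l.2)) ?_ ?_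
    · intro l m
      refine Eq.trans (hoD' l m) ?_
      simp only [Fin.ext_iff]
    · intro l m
      have h1 := heD l (eD m)
      have h2 := hoD' m l
      rw [h2] at h1
      have h3 : j (eD l : V) = 0 := (eD l).2
      simp only [am, h3, inner_zero_right, mul_zero, sub_zero]
      refine Eq.trans h1 ?_
      simp only [Fin.ext_iff, eq_comm (a := (m : ℕ))]
      split_ifs <;> simp
  have hnorm : ∀ μ ≤ 0, ∀ k, ‖i (e μ k)‖ = 1 := fun μ hμ k => (he μ hμ).2.1 k
  have hQ : ∀ μ ≤ 0, ∀ k, (a (e μ k) (e μ k)).re + -μ * ‖j (e μ k)‖ ^ 2 = lam μ k := by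
    intro μ hμ k
    rw [← hmQre, (he μ hμ).1 k (e μ k), inner_self_eq_norm_sq_to_K, hnorm μ hμ k]
    simp
  have hlow : ∀ μ ≤ 0, ∀ k, 0 ≤ lam μ k := by
    intro μ hμ k
    rw [← hQ μ hμ k, ← hmQre]
    exact (hmpos μ hμ _).1
  rw [tendsto_iff_ultrafilter]
  intro U hU
  have hneg : ∀ᶠ μ : ℝ in U, μ ≤ 0 := hU (eventually_le_atBot 0)
  have hbd : ∀ k, ∀ᶠ μ : ℝ in U, ‖e μ k‖ ≤ Real.sqrt ((lamD k + ω) / δ) := by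
    intro k
    filter_upwards [hneg] with μ hμ
    apply Real.le_sqrt_of_sq_le
    rw [le_div_iff₀ hδ]
    have h1 := hell (e μ k)
    have h2 := hQ μ hμ k
    have h3 := hup μ hμ k
    have h4 : 0 ≤ -μ * ‖j (e μ k)‖ ^ 2 := mul_nonneg (by linarith) (by positivity)
    rw [hnorm μ hμ k] at h1
    linarith
  choose w hw using fun k => aux_weak_lim U (fun μ => e μ k) _ (hbd k)
  have hiw := fun k => aux_strong_lim hicpt U (fun μ => e μ k) _ (hbd k) (w k) (hw k)
  have hell' : ∀ k, ∃ l : ℝ, Tendsto (fun μ => lam μ k) U (𝓝 l) := by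
    intro k
    obtain ⟨l, -, hl⟩ := aux_ultra_lim (isCompact_Icc (a := 0) (b := lamD k)) U
      (fun μ => lam μ k) (by
        filter_upwards [hneg] with μ hμ
        exact ⟨hlow μ hμ k, hup μ hμ k⟩)
    exact ⟨l, hl⟩
  choose l hl using hell'
  have hlup : l n ≤ lamD n := le_of_tendsto (hl n) (by
    filter_upwards [hneg] with μ hμ
    exact hup μ hμ n)
  have hlmono : ∀ k ≤ n, l k ≤ l n := fun k hk =>
    le_of_tendsto_of_tendsto' (hl k) (hl n) fun μ => (hlam μ).1 hk
  have hjw : ∀ k, j (w k) = 0 := by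
    intro k
    have h1 := aux_strong_lim hjcpt U (fun μ => e μ k) _ (hbd k) (w k) (hw k)
    have h2 : Tendsto (fun μ : ℝ => lamD k / (-μ)) U (𝓝 0) :=
      (tendsto_const_nhds.div_atTop tendsto_neg_atBot_atTop).mono_left hU
    have h3 : Tendsto (fun μ : ℝ => ‖j (e μ k)‖ ^ 2) U (𝓝 0) := by
      refine squeeze_zero' (Eventually.of_forall fun _ => by positivity) ?_ h2
      filter_upwards [hU (eventually_lt_atBot 0)] with μ hμ
      rw [le_div_iff₀ (by linarith)]
      have h4 := hQ μ hμ.le k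
      have h5 := hup μ hμ.le k
      have h6 := (hpos (e μ k)).1
      linarith
    have h4 := tendsto_nhds_unique (h1.norm.pow 2) h3
    simpa using h4
  have hwi : ∀ k m, @inner ℂ _ _ (i (w k)) (i (w m)) = if k = m then 1 else 0 := by
    intro k m
    refine tendsto_nhds_unique ((hiw k).inner (hiw m)) (tendsto_const_nhds.congr' ?_)
    filter_upwards [hneg] with μ hμ
    exact (orthonormal_iff_ite.1 (he μ hμ).2 k m).symm
  have hwa : ∀ k v, j v = 0 → a (w k) v = l k * @inner ℂ _ _ (i v) (i (w k)) := by
    intro k v hv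
    obtain ⟨φ, hφ⟩ := aux_functional hsesq hcont v
    have h1 := hw k φ
    rw [← hφ]
    have h2 : Tendsto (fun μ => (lam μ k : ℂ) * @inner ℂ _ _ (i v) (i (e μ k))) U
        (𝓝 (l k * @inner ℂ _ _ (i v) (i (w k)))) :=
      ((Complex.continuous_ofReal.tendsto _).comp (hl k)).mul (tendsto_const_nhds.inner (hiw k))
    refine tendsto_nhds_unique h1 (h2.congr' ?_)
    filter_upwards [hneg] with μ hμ
    have h3 := (he μ hμ).1 k v
    simp only [am, hv, inner_zero_left, mul_zero, sub_zero] at h3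
    rw [hφ, h3]
  have hlo : lamD n ≤ l n := by
    refine aux_minmax iD hiDinj hiDc aD hDs hDc hDsymm hDpos hDell lamD hDmono hDfin hDcard' n
      (fun k => ⟨w k, hjw k⟩) (fun k => l k) (l n) (fun k => hlmono k (Nat.lt_succ_iff.1 k.2))
      ?_ ?_
    · intro k m
      refine Eq.trans (hwi k m) ?_
      simp only [Fin.ext_iff]
    · intro k m
      refine Eq.trans (hwa k (w m) (hjw m)) ?_
      rw [hwi]
      simp only [Fin.ext_iff, eq_comm (a := (m : ℕ))]
      split_ifs <;> simp
  rw [le_antisymm hlo hlup]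
  exact hl n
end
end

section
/- Let V, H, K be Hilbert spaces with compact inclusion i : V → H and compact linear j : V → K, and 𝔞 : V × V → ℂ a positive symmetric continuous i-elliptic sesquilinear form with V_D = ker j. Assume the self-adjoint operator A^N associated with 𝔞 has no eigenvector in V_D. For μ ∈ ℝ let A_μ be the self-adjoint graph associated with (𝔞_μ, i), where 𝔞_μ(u,v) = 𝔞(u,v) − μ(j(u), j(v))_K, with eigenvalues λ₁(μ) ≤ λ₂(μ) ≤ … repeated with multiplicity. Then for every n ∈ ℕ, the function μ ↦ λ_n(μ) is strictly decreasing on ℝ. -/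
/-!
Abstract framework for forms, graphs (linear relations) and their spectra,
following Arendt--ter Elst style form methods.
-/

noncomputable section
open Complex Filter Topology ComplexConjugate

local notation "⟪" x ", " y "⟫" => @inner ℂ _ _ x y

section Aux

variable {V H K : Type*}
  [NormedAddCommGroup V] [InnerProductSpace ℂ V] [CompleteSpace V]
  [NormedAddCommGroup H] [InnerProductSpace ℂ H] [CompleteSpace H]
  [NormedAddCommGroup K] [InnerProductSpace ℂ K] [CompleteSpace K]

theorem aux_form_rep (a : V → V → ℂ) (hsesq : IsSesqui a) (hsymm : IsSymmForm a)
    (hcont : IsContinuousForm a) :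
    ∃ B : V →L[ℂ] V, ∀ u v, ⟪v, B u⟫ = a u v := by
  obtain ⟨h1, h2, h3, h4⟩ := hsesq
  obtain ⟨M, hM, hb⟩ := hcont
  let f : V →ₗ⋆[ℂ] V →ₗ[ℂ] ℂ := LinearMap.mk₂'ₛₗ (starRingEnd ℂ) (RingHom.id ℂ)
    (fun v w => a w v) (fun v v' w => h2 w v v') (fun c v w => h4 c w v)
    (fun v w w' => h1 w w' v) (fun c v w => h3 c w v)
  let F : V →L⋆[ℂ] V →L[ℂ] ℂ := f.mkContinuous₂ M (fun v w => by
    have := hb w v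
    simp only [f, LinearMap.mk₂'ₛₗ_apply]
    nlinarith)
  refine ⟨InnerProductSpace.continuousLinearMapOfBilin F, fun u v => ?_⟩
  rw [← inner_conj_symm, InnerProductSpace.continuousLinearMapOfBilin_apply, hsymm v u]
  rfl

theorem aux_ehrling (i : V →L[ℂ] H) (hinj : Function.Injective ⇑i)
    (j : V →L[ℂ] K) (hjcpt : IsCompactOperator ⇑j) (ε : ℝ) (hε : 0 < ε) :
    ∃ C : ℝ, 0 ≤ C ∧ ∀ u, ‖j u‖ ^ 2 ≤ ε * ‖u‖ ^ 2 + C * ‖i u‖ ^ 2 := by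
  -- range of adjoint is dense
  have hdense : ∀ y : V, ∀ δ > 0, ∃ h : H, ‖y - i.adjoint h‖ < δ := by
    intro y δ hδ
    have h0 : (i.adjoint.range)ᗮ = ⊥ := by
      rw [ContinuousLinearMap.orthogonal_range, ContinuousLinearMap.adjoint_adjoint]
      exact LinearMap.ker_eq_bot.mpr hinj
    have h1 : y ∈ closure (Set.range i.adjoint) := by
      have := (Submodule.topologicalClosure_eq_top_iff (K := i.adjoint.range)).mpr h0
      have hy : y ∈ (i.adjoint.range).topologicalClosure := by rw [this]; trivial
      exact hy
    obtain ⟨z, ⟨h, rfl⟩, hz⟩ := Metric.mem_closure_iff.mp h1 δ hδ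
    exact ⟨h, by rwa [dist_eq_norm] at hz⟩
  -- weak estimate
  have key : ∀ δ > 0, ∃ C : ℝ, 0 ≤ C ∧ ∀ u, ‖u‖ ≤ 1 → ‖j u‖ ^ 2 ≤ δ + C * ‖i u‖ := by
    intro δ hδ
    set η : ℝ := δ / (2 * (‖j‖ + 1)) with hη
    have hj0 : 0 ≤ ‖j‖ := norm_nonneg _
    have hηpos : 0 < η := by positivity
    have htb : TotallyBounded (j '' Metric.closedBall 0 1) := by
      have := IsCompactOperator.isCompact_closure_image_closedBall (𝕜₁ := ℂ) (f := (j : V →ₗ[ℂ] K)) hjcpt 1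
      exact this.totallyBounded.subset subset_closure
    obtain ⟨s, hs, hsub⟩ := Metric.totallyBounded_iff.mp htb η hηpos
    choose h hh using fun y : K => hdense (j.adjoint y) (δ / 2) (by positivity)
    lift s to Finset K using hs
    refine ⟨∑ y ∈ s, ‖h y‖, Finset.sum_nonneg fun _ _ => norm_nonneg _, fun u hu => ?_⟩
    have hmem : j u ∈ j '' Metric.closedBall 0 1 := ⟨u, by simpa using hu, rfl⟩
    obtain ⟨y, hy, hyu⟩ : ∃ y ∈ s, j u ∈ Metric.ball y η := by simpa using hsub hmem
    rw [mem_ball_iff_norm] at hyu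
    have e1 : ⟪j u, j u⟫ = ⟪j u, j u - y⟫ + ⟪u, j.adjoint y - i.adjoint (h y)⟫ + ⟪i u, h y⟫ := by
      rw [inner_sub_right, inner_sub_right, ContinuousLinearMap.adjoint_inner_right,
        ContinuousLinearMap.adjoint_inner_right]
      ring
    have e2 : ‖j u‖ ^ 2 = ‖⟪j u, j u⟫‖ := by
      rw [inner_self_eq_norm_sq_to_K]; simp
    have b1 : ‖⟪j u, j u - y⟫‖ ≤ δ / 2 := by
      calc _ ≤ ‖j u‖ * ‖j u - y‖ := norm_inner_le_norm _ _
        _ ≤ (‖j‖ + 1) * η := by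
          gcongr
          have := j.le_opNorm u
          nlinarith
        _ = δ / 2 := by rw [hη]; field_simp
    have b2 : ‖⟪u, j.adjoint y - i.adjoint (h y)⟫‖ ≤ δ / 2 := by
      calc _ ≤ ‖u‖ * ‖j.adjoint y - i.adjoint (h y)‖ := norm_inner_le_norm _ _
        _ ≤ 1 * (δ / 2) := by gcongr; exact (hh y).le
        _ = _ := by ring
    have b3 : ‖⟪i u, h y⟫‖ ≤ (∑ y ∈ s, ‖h y‖) * ‖i u‖ := by
      calc _ ≤ ‖i u‖ * ‖h y‖ := norm_inner_le_norm _ _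
        _ ≤ ‖i u‖ * (∑ y ∈ s, ‖h y‖) := by
          gcongr
          exact Finset.single_le_sum (f := fun y => ‖h y‖) (fun _ _ => norm_nonneg _) hy
        _ = _ := by ring
    rw [e2, e1]
    calc _ ≤ _ := norm_add₃_le
      _ ≤ _ := by linarith
  obtain ⟨C, hC, hk⟩ := key (ε / 2) (by positivity)
  refine ⟨C ^ 2 / (2 * ε), by positivity, fun u => ?_⟩
  by_cases hu : u = 0
  · simp [hu]
  have hn : 0 < ‖u‖ := norm_pos_iff.mpr hu
  have := hk (((‖u‖⁻¹ : ℝ) : ℂ) • u) (by rw [norm_smul]; simp [hn.ne'])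
  rw [map_smul, map_smul, norm_smul, norm_smul] at this
  simp only [Complex.norm_real, norm_inv, norm_norm] at this
  have h3 : ‖j u‖ ^ 2 ≤ ε / 2 * ‖u‖ ^ 2 + C * ‖i u‖ * ‖u‖ := by
    have h4 := mul_le_mul_of_nonneg_left this (sq_nonneg ‖u‖)
    have e1 : ‖u‖ ^ 2 * (‖u‖⁻¹ * ‖j u‖) ^ 2 = ‖j u‖ ^ 2 := by field_simp
    have e2 : ‖u‖ ^ 2 * (ε / 2 + C * (‖u‖⁻¹ * ‖i u‖)) = ε / 2 * ‖u‖ ^ 2 + C * ‖i u‖ * ‖u‖ := by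
      field_simp
    linarith
  have h5 : C * ‖i u‖ * ‖u‖ ≤ ε / 2 * ‖u‖ ^ 2 + C ^ 2 / (2 * ε) * ‖i u‖ ^ 2 := by
    have : ε / 2 * ‖u‖ ^ 2 + C ^ 2 / (2 * ε) * ‖i u‖ ^ 2 - C * ‖i u‖ * ‖u‖
        = (ε * ‖u‖ - C * ‖i u‖) ^ 2 / (2 * ε) := by field_simp; ring
    have : 0 ≤ (ε * ‖u‖ - C * ‖i u‖) ^ 2 / (2 * ε) := by positivity
    linarith
  linarith

/-- The operator `i† i`. -/
def auxJ (i : V →L[ℂ] H) : V →L[ℂ] V := i.adjoint ∘L i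

theorem auxJ_inner (i : V →L[ℂ] H) (u v : V) : ⟪v, auxJ i u⟫ = ⟪i v, i u⟫ := by
  simp [auxJ, ContinuousLinearMap.adjoint_inner_right]

theorem auxJ_symm (i : V →L[ℂ] H) (u v : V) : ⟪auxJ i v, u⟫ = ⟪v, auxJ i u⟫ := by
  simp [auxJ, ContinuousLinearMap.adjoint_inner_right, ContinuousLinearMap.adjoint_inner_left]

theorem auxJ_re (i : V →L[ℂ] H) (u : V) : (⟪u, auxJ i u⟫).re = ‖i u‖ ^ 2 := by
  rw [auxJ_inner, inner_self_eq_norm_sq_to_K]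
  norm_cast

/-- Eigenspace in `V`. -/
def auxEV (B : V →L[ℂ] V) (i : V →L[ℂ] H) (s : ℝ) : Submodule ℂ V where
  carrier := {u | B u = (s : ℂ) • auxJ i u}
  add_mem' := by
    intro x y hx hy
    simp only [Set.mem_ofPred_eq] at *
    rw [map_add, map_add, hx, hy, smul_add]
  zero_mem' := by simp
  smul_mem' := by
    intro c x hx
    simp only [Set.mem_ofPred_eq] at *
    rw [map_smul, map_smul, hx, smul_comm]

theorem mem_auxEV {B : V →L[ℂ] V} {i : V →L[ℂ] H} {s : ℝ} {u : V} :
    u ∈ auxEV B i s ↔ B u = (s : ℂ) • auxJ i u := Iff.rfl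

/-- coercivity -/
def auxCoer (B : V →L[ℂ] V) (i : V →L[ℂ] H) (ω : ℝ) : Prop :=
  ∃ m : ℝ, 0 < m ∧ ∀ u, m * ‖u‖ ^ 2 ≤ (⟪u, B u⟫).re + ω * ‖i u‖ ^ 2

theorem auxCoer.mono {B : V →L[ℂ] V} {i : V →L[ℂ] H} {ω ω' : ℝ} (h : auxCoer B i ω)
    (hω : ω ≤ ω') : auxCoer B i ω' := by
  obtain ⟨m, hm, h⟩ := h
  refine ⟨m, hm, fun u => (h u).trans ?_⟩
  gcongr

theorem auxCoer.inv {B : V →L[ℂ] V} {i : V →L[ℂ] H} {ω : ℝ} (h : auxCoer B i ω) :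
    ∃ G : V →L[ℂ] V, (∀ u, B (G u) + (ω : ℂ) • auxJ i (G u) = u) ∧
      ∀ u, G (B u + (ω : ℂ) • auxJ i u) = u := by
  obtain ⟨m, hm, h⟩ := h
  have hu : IsUnit (B + (ω : ℂ) • auxJ i) := by
    refine ContinuousLinearMap.isUnit_of_forall_le_norm_inner_map _ (c := ⟨m, hm.le⟩) hm
      fun x => ?_
    rw [← inner_conj_symm, RCLike.norm_conj]
    refine le_trans ?_ (Complex.re_le_norm _)
    have := h x
    simp only [add_apply, smul_apply, inner_add_right,
      inner_smul_right, Complex.add_re, Complex.re_ofReal_mul, auxJ_re]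
    change ‖x‖ ^ 2 * m ≤ _
    linarith
  obtain ⟨U, hU⟩ := hu
  refine ⟨(↑U⁻¹ : V →L[ℂ] V), fun u => ?_, fun u => ?_⟩
  · have : ((U : V →L[ℂ] V) * (↑U⁻¹ : V →L[ℂ] V)) u = u := by rw [U.mul_inv]; rfl
    rw [hU] at this
    exact this
  · have : ((↑U⁻¹ : V →L[ℂ] V) * (U : V →L[ℂ] V)) u = u := by rw [U.inv_mul]; rfl
    rw [hU] at this
    exact this

theorem aux_findim {B : V →L[ℂ] V} {i : V →L[ℂ] H} {ω : ℝ} (h : auxCoer B i ω)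
    (hicpt : IsCompactOperator ⇑i) (s : ℝ) : FiniteDimensional ℂ (auxEV B i s) := by
  have h' := h.mono (le_max_left ω (1 - s))
  set w := max ω (1 - s) with hw
  have hs : 0 < s + w := by have := le_max_right ω (1 - s); linarith
  obtain ⟨G, h1, h2⟩ := h'.inv
  have hcpt : IsCompactOperator ⇑(G ∘L (i.adjoint ∘L i)) :=
    (hicpt.clm_comp i.adjoint).clm_comp G
  have hne : (((s + w)⁻¹ : ℝ) : ℂ) ≠ 0 := by
    exact_mod_cast (inv_pos.mpr hs).ne'
  have := ContinuousLinearMap.finite_dimensional_eigenspace hcpt _ hne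
  refine Submodule.finiteDimensional_of_le
    (S₂ := Module.End.eigenspace (G ∘L (i.adjoint ∘L i)).toLinearMap (((s + w)⁻¹ : ℝ) : ℂ)) ?_
  intro u hu
  rw [Module.End.mem_eigenspace_iff]
  have e := h2 u
  rw [mem_auxEV.mp hu, ← add_smul, map_smul] at e
  change G (auxJ i u) = _
  have hne2 : (s : ℂ) + w ≠ 0 := by exact_mod_cast hs.ne'
  conv_rhs => rw [← e]
  rw [smul_smul]
  push_cast
  rw [inv_mul_cancel₀ hne2, one_smul]

theorem aux_estimate {B : V →L[ℂ] V} {i : V →L[ℂ] H} {ω : ℝ} (h : auxCoer B i ω)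
    (hB : ∀ u v, ⟪B v, u⟫ = ⟪v, B u⟫)
    (hicpt : IsCompactOperator ⇑i) (t : ℝ) (ht : 0 < t + ω) (F : Submodule ℂ V)
    (h1 : ∀ u ∈ F, ∃ w ∈ F, B w + (ω : ℂ) • auxJ i w = auxJ i u)
    (h2 : ∀ s : ℝ, s < t → auxEV B i s ≤ F)
    (u : V) (hu : ∀ w ∈ F, ⟪w, auxJ i u⟫ = 0) :
    t * ‖i u‖ ^ 2 ≤ (⟪u, B u⟫).re := by
  obtain ⟨G, hG1, hG2⟩ := h.inv
  obtain ⟨m, hm, hcoer⟩ := h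
  -- `T = B + ω J`
  set T : V →L[ℂ] V := B + (ω : ℂ) • auxJ i with hT
  have hTa : ∀ x, T x = B x + (ω : ℂ) • auxJ i x := fun x => rfl
  have hTsymm : ∀ x y, ⟪T y, x⟫ = ⟪y, T x⟫ := by
    intro x y
    rw [hTa, hTa, inner_add_left, inner_add_right, inner_smul_left, inner_smul_right, hB,
      auxJ_symm, Complex.conj_ofReal]
  have hTG : ∀ x, T (G x) = x := hG1
  have hGT : ∀ x, G (T x) = x := hG2
  have hGsymm : ∀ x y, ⟪G y, x⟫ = ⟪y, G x⟫ := by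
    intro x y
    conv_lhs => rw [← hTG x]
    rw [← hTsymm, hTG]
  have hTpos : ∀ x, 0 ≤ (⟪x, T x⟫).re := by
    intro x
    have := hcoer x
    rw [hTa, inner_add_right, inner_smul_right, Complex.add_re, Complex.re_ofReal_mul, auxJ_re]
    have : 0 ≤ m * ‖x‖ ^ 2 := by positivity
    linarith
  -- the resolvent in `H`
  set R : H →L[ℂ] H := i ∘L (G ∘L i.adjoint) with hR
  have hRa : ∀ f, R f = i (G (i.adjoint f)) := fun f => rfl
  have hRcpt : IsCompactOperator ⇑R := hicpt.comp_clm (G ∘L i.adjoint)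
  set F' : Submodule ℂ H := F.map (i : V →ₗ[ℂ] H) with hF'
  set P : H →L[ℂ] H := F'ᗮ.starProjection with hP
  have hPsa : ∀ x y, ⟪P x, y⟫ = ⟪x, P y⟫ := fun x y =>
    Submodule.inner_starProjection_left_eq_right _ _ _
  have hPmem : ∀ x, P x ∈ F'ᗮ := fun x => Submodule.starProjection_apply_mem _ _
  have hPid : ∀ x ∈ F'ᗮ, P x = x := fun x hx => Submodule.starProjection_eq_self_iff.mpr hx
  have hRsymm : ∀ x y, ⟪R x, y⟫ = ⟪x, R y⟫ := by
    intro x y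
    rw [hRa, hRa, ← ContinuousLinearMap.adjoint_inner_right, hGsymm,
      ContinuousLinearMap.adjoint_inner_left]
  have hRF : ∀ x ∈ F'ᗮ, R x ∈ F'ᗮ := by
    intro x hx
    rw [Submodule.mem_orthogonal] at hx ⊢
    rintro _ ⟨e, he, rfl⟩
    obtain ⟨w, hw, hwe⟩ := h1 e he
    have : R (i e) = i w := by
      rw [hRa]
      change i (G (auxJ i e)) = _
      rw [← hwe, ← hTa, hGT]
    rw [← hRsymm]
    change ⟪R (i e), x⟫ = 0
    rw [this]
    exact hx _ ⟨w, hw, rfl⟩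
  set Q : H →L[ℂ] H := P ∘L (R ∘L P) with hQ
  have hQa : ∀ x, Q x = P (R (P x)) := fun x => rfl
  have hQcpt : IsCompactOperator ⇑Q := (hRcpt.comp_clm P).clm_comp P
  have hQsa : IsSelfAdjoint Q := by
    rw [ContinuousLinearMap.isSelfAdjoint_iff_isSymmetric]
    intro x y
    change ⟪Q x, y⟫ = ⟪x, Q y⟫
    rw [hQa, hQa, hPsa, hRsymm, hPsa]
  set ρ : ℝ := (t + ω)⁻¹ with hρ
  have hρpos : 0 < ρ := inv_pos.mpr ht
  have hspec : ∀ x ∈ spectrum ℝ Q, x ≤ ρ := by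
    intro r hr
    by_contra! hlt
    have hr0 : 0 < r := hρpos.trans hlt
    have hr' : (r : ℂ) ∈ spectrum ℂ Q := by
      have := (spectrum.algebraMap_mem_iff ℂ (a := Q) (r := r)).mpr hr
      simpa using this
    have hrne : (r : ℂ) ≠ 0 := by exact_mod_cast hr0.ne'
    have hev := (IsCompactOperator.hasEigenvalue_iff_mem_spectrum hQcpt hrne).mpr hr'
    obtain ⟨x, hx⟩ := hev.exists_hasEigenvector
    have hx0 := hx.2
    have hxe : Q x = (r : ℂ) • x := hx.apply_eq_smul
    have hxmem : x ∈ F'ᗮ := by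
      have : x = (r : ℂ)⁻¹ • Q x := by rw [hxe, smul_smul, inv_mul_cancel₀ hrne, one_smul]
      rw [this]
      exact Submodule.smul_mem _ _ (hPmem _)
    have hRx : R x = (r : ℂ) • x := by
      rw [hQa, hPid x hxmem, hPid _ (hRF x hxmem)] at hxe
      exact hxe
    have hz : i (G (i.adjoint x)) = (r : ℂ) • x := hRx
    have hTz : T (G (i.adjoint x)) = (r : ℂ)⁻¹ • auxJ i (G (i.adjoint x)) := by
      rw [hTG]
      change _ = (r : ℂ)⁻¹ • i.adjoint (i (G (i.adjoint x)))
      rw [hz, map_smul, smul_smul, inv_mul_cancel₀ hrne, one_smul]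
    have hzE : G (i.adjoint x) ∈ auxEV B i (r⁻¹ - ω) := by
      rw [mem_auxEV]
      push_cast
      rw [sub_smul, ← hTz, hTa]
      abel
    have hzF : G (i.adjoint x) ∈ F := by
      refine h2 _ ?_ hzE
      have : r⁻¹ < t + ω := by
        rw [inv_lt_comm₀ hr0 ht]
        exact hlt
      linarith
    have hxF : (r : ℂ) • x ∈ F' := by
      rw [← hz]
      exact ⟨_, hzF, rfl⟩
    have hxF2 : x ∈ F' := (Submodule.smul_mem_iff _ hrne).mp hxF
    have : ⟪x, x⟫ = 0 := (Submodule.mem_orthogonal _ _).mp hxmem x hxF2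
    exact hx0 (inner_self_eq_zero.mp this)
  have hle : Q ≤ algebraMap ℝ (H →L[ℂ] H) ρ := le_algebraMap_of_spectrum_le hspec hQsa
  have hRle : ∀ x ∈ F'ᗮ, (⟪x, R x⟫).re ≤ ρ * ‖x‖ ^ 2 := by
    intro x hx
    have h3 := (ContinuousLinearMap.le_def _ _).mp hle
    have h4 := h3.re_inner_nonneg_right x
    have e : (algebraMap ℝ (H →L[ℂ] H) ρ - Q) x = (ρ : ℂ) • x - R x := by
      change (algebraMap ℝ (H →L[ℂ] H) ρ) x - Q x = _
      rw [hQa, hPid x hx, hPid _ (hRF x hx)]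
      congr 1
    rw [e, inner_sub_right, inner_smul_right, inner_self_eq_norm_sq_to_K] at h4
    have h5 : 0 ≤ ((ρ : ℂ) * ((‖x‖ : ℝ) : ℂ) ^ 2 - ⟪x, R x⟫).re := h4
    rw [Complex.sub_re] at h5
    have h6 : ((ρ : ℂ) * ((‖x‖ : ℝ) : ℂ) ^ 2).re = ρ * ‖x‖ ^ 2 := by norm_cast
    rw [h6] at h5
    linarith
  -- final computation
  have hiu : i u ∈ F'ᗮ := by
    rw [Submodule.mem_orthogonal]
    rintro _ ⟨e, he, rfl⟩
    have := hu e he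
    rwa [auxJ_inner] at this
  set w := G (auxJ i u) with hw
  have hTw : T w = auxJ i u := hTG _
  have hww : (⟪w, T w⟫).re ≤ ρ * ‖i u‖ ^ 2 := by
    have := hRle _ hiu
    have e : ⟪w, T w⟫ = ⟪i u, R (i u)⟫ := by
      rw [← hTsymm, hTw, hRa, auxJ, ContinuousLinearMap.comp_apply,
        ContinuousLinearMap.adjoint_inner_left]
      rfl
    rw [e]; exact this
  have huw : (⟪u, T w⟫).re = ‖i u‖ ^ 2 := by rw [hTw, auxJ_re]
  have hwu : (⟪w, T u⟫).re = ‖i u‖ ^ 2 := by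
    rw [← hTsymm, ← inner_conj_symm, Complex.conj_re, huw]
  set α : ℝ := t + ω with hα
  have hp := hTpos (u - (α : ℂ) • w)
  have hexp : (⟪u - (α : ℂ) • w, T (u - (α : ℂ) • w)⟫).re
      = (⟪u, T u⟫).re - 2 * α * ‖i u‖ ^ 2 + α ^ 2 * (⟪w, T w⟫).re := by
    rw [map_sub, map_smul, inner_sub_left, inner_sub_right, inner_sub_right, inner_smul_left,
      inner_smul_left, inner_smul_right, inner_smul_right, Complex.conj_ofReal]
    simp only [Complex.sub_re, Complex.re_ofReal_mul, huw, hwu]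
    ring
  have hTu : (⟪u, T u⟫).re = (⟪u, B u⟫).re + ω * ‖i u‖ ^ 2 := by
    rw [hTa, inner_add_right, inner_smul_right, Complex.add_re, Complex.re_ofReal_mul, auxJ_re]
  have hαρ : α ^ 2 * (ρ * ‖i u‖ ^ 2) = α * ‖i u‖ ^ 2 := by
    rw [hρ]; field_simp
  have := mul_le_mul_of_nonneg_left hww (sq_nonneg α)
  rw [hexp, hTu] at hp
  rw [hαρ] at this
  have : (t + ω) * ‖i u‖ ^ 2 = t * ‖i u‖ ^ 2 + ω * ‖i u‖ ^ 2 := by ring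
  nlinarith


/-- Sum of finitely many eigenspaces. -/
def auxSum (B : V →L[ℂ] V) (i : V →L[ℂ] H) (S : Finset ℝ) : Submodule ℂ V :=
  ⨆ s ∈ S, auxEV B i s

theorem aux_orth {B : V →L[ℂ] V} {i : V →L[ℂ] H} (hB : ∀ u v, ⟪B v, u⟫ = ⟪v, B u⟫)
    {s r : ℝ} (hsr : s ≠ r) {u v : V} (hu : u ∈ auxEV B i s) (hv : v ∈ auxEV B i r) :
    ⟪u, auxJ i v⟫ = 0 := by
  have h := hB v u
  rw [mem_auxEV.mp hu, mem_auxEV.mp hv, inner_smul_left, inner_smul_right, auxJ_symm,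
    Complex.conj_ofReal] at h
  have : ((s : ℂ) - r) * ⟪u, auxJ i v⟫ = 0 := by rw [sub_mul, h, sub_self]
  rcases mul_eq_zero.mp this with h0 | h0
  · exact absurd (by exact_mod_cast sub_eq_zero.mp h0) hsr
  · exact h0

theorem auxSum_induction {B : V →L[ℂ] V} {i : V →L[ℂ] H} {S : Finset ℝ} {p : V → Prop}
    (h : ∀ s ∈ S, ∀ u ∈ auxEV B i s, p u) (h0 : p 0) (hadd : ∀ u v, p u → p v → p (u + v))
    {u : V} (hu : u ∈ auxSum B i S) : p u := by
  rw [auxSum, Submodule.mem_iSup_finset_iff_exists_sum] at hu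
  obtain ⟨f, rfl⟩ := hu
  exact Finset.sum_induction _ p hadd h0 fun s hs => h s hs _ (f s).2

theorem auxSum_orth {B : V →L[ℂ] V} {i : V →L[ℂ] H} (hB : ∀ u v, ⟪B v, u⟫ = ⟪v, B u⟫)
    {s : ℝ} {S : Finset ℝ} (hs : s ∉ S) {u v : V} (hu : u ∈ auxEV B i s)
    (hv : v ∈ auxSum B i S) : ⟪u, auxJ i v⟫ = 0 := by
  refine auxSum_induction (p := fun v => ⟪u, auxJ i v⟫ = 0) ?_ (by simp) ?_ hv
  · intro r hr w hw
    have hne : s ≠ r := by rintro rfl; exact hs hr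
    exact aux_orth hB hne hu hw
  · intro x y hx hy
    rw [map_add, inner_add_right, hx, hy, add_zero]

theorem auxSum_findim {B : V →L[ℂ] V} {i : V →L[ℂ] H} {ω : ℝ} (h : auxCoer B i ω)
    (hicpt : IsCompactOperator ⇑i) (S : Finset ℝ) : FiniteDimensional ℂ (auxSum B i S) := by
  have := fun s => aux_findim h hicpt s
  exact Submodule.finiteDimensional_finset_sup S (auxEV B i) |> fun h => by
    rw [Finset.sup_eq_iSup] at h; exact h

theorem auxSum_finrank {B : V →L[ℂ] V} {i : V →L[ℂ] H} {ω : ℝ} (h : auxCoer B i ω)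
    (hinj : Function.Injective ⇑i)
    (hB : ∀ u v, ⟪B v, u⟫ = ⟪v, B u⟫)
    (hicpt : IsCompactOperator ⇑i) (S : Finset ℝ) :
    Module.finrank ℂ (auxSum B i S) = ∑ s ∈ S, Module.finrank ℂ (auxEV B i s) := by
  classical
  induction S using Finset.induction_on with
  | empty =>
    have e : auxSum B i ∅ = ⊥ := by simp [auxSum]
    rw [e]; simp
  | insert s S hs ih =>
    rw [Finset.sum_insert hs, ← ih]
    have e : auxSum B i (insert s S) = auxEV B i s ⊔ auxSum B i S := by
      rw [auxSum, Finset.iSup_insert]; rfl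
    have := aux_findim h hicpt s
    have := auxSum_findim h hicpt S
    have hinf : auxEV B i s ⊓ auxSum B i S = ⊥ := by
      rw [eq_bot_iff]
      rintro u ⟨hu1, hu2⟩
      have h0 := auxSum_orth hB hs hu1 hu2
      rw [auxJ_inner] at h0
      have := inner_self_eq_zero.mp h0
      exact hinj (by simpa using this)
    have h3 := Submodule.finrank_sup_add_finrank_inf_eq (auxEV B i s) (auxSum B i S)
    rw [hinf, finrank_bot, add_zero] at h3
    rw [e, h3]

theorem auxSum_upper {B : V →L[ℂ] V} {i : V →L[ℂ] H} (hB : ∀ u v, ⟪B v, u⟫ = ⟪v, B u⟫)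
    (S : Finset ℝ) (t : ℝ) (hS : ∀ s ∈ S, s ≤ t) {u : V} (hu : u ∈ auxSum B i S) :
    (⟪u, B u⟫).re ≤ t * ‖i u‖ ^ 2 := by
  classical
  induction S using Finset.induction_on generalizing u with
  | empty =>
    have : u = 0 := by simpa [auxSum] using hu
    simp [this]
  | insert s S hs ih =>
    have e : auxSum B i (insert s S) = auxEV B i s ⊔ auxSum B i S := by
      rw [auxSum, Finset.iSup_insert]; rfl
    rw [e] at hu
    obtain ⟨x, hx, y, hy, rfl⟩ := Submodule.mem_sup.mp hu
    have h0 := auxSum_orth hB hs hx hy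
    have h0' : ⟪y, auxJ i x⟫ = 0 := by
      rw [← auxJ_symm, ← inner_conj_symm, h0, map_zero]
    have hyB := ih (fun r hr => hS r (Finset.mem_insert_of_mem hr)) hy
    have hst := hS s (Finset.mem_insert_self _ _)
    have e1 : ⟪x + y, B (x + y)⟫ = s * ⟪x, auxJ i x⟫ + ⟪y, B y⟫ := by
      rw [map_add, inner_add_left, inner_add_right, inner_add_right, ← hB y x,
        mem_auxEV.mp hx, inner_smul_left, inner_smul_right, inner_smul_right, h0', auxJ_symm, h0]
      ring
    have e2 : ‖i (x + y)‖ ^ 2 = ‖i x‖ ^ 2 + ‖i y‖ ^ 2 := by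
      rw [← auxJ_re, ← auxJ_re, ← auxJ_re, map_add, inner_add_left, inner_add_right,
        inner_add_right, h0, h0']
      simp
    rw [e1, e2, Complex.add_re, Complex.re_ofReal_mul, auxJ_re]
    have := mul_le_mul_of_nonneg_right hst (sq_nonneg ‖i x‖)
    linarith

theorem auxSum_lower {B : V →L[ℂ] V} {i : V →L[ℂ] H} {ω : ℝ} (h : auxCoer B i ω)
    (hB : ∀ u v, ⟪B v, u⟫ = ⟪v, B u⟫)
    (hicpt : IsCompactOperator ⇑i) (t : ℝ) (S : Finset ℝ)
    (h2 : ∀ s : ℝ, s < t → auxEV B i s ≤ auxSum B i S)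
    (u : V) (hu : ∀ w ∈ auxSum B i S, ⟪w, auxJ i u⟫ = 0) :
    t * ‖i u‖ ^ 2 ≤ (⟪u, B u⟫).re := by
  have h' := h.mono (le_max_left ω (1 - t))
  set w := max ω (1 - t) with hw
  have ht : 0 < t + w := by have := le_max_right ω (1 - t); linarith
  refine aux_estimate h' hB hicpt t ht (auxSum B i S) ?_ h2 u hu
  obtain ⟨G, hG1, hG2⟩ := h'.inv
  intro x hx
  refine auxSum_induction (p := fun x => ∃ y ∈ auxSum B i S,
    B y + (w : ℂ) • auxJ i y = auxJ i x) ?_ ⟨0, Submodule.zero_mem _, by simp⟩ ?_ hx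
  · intro s hs x hx
    have e : B x + (w : ℂ) • auxJ i x = ((s + w : ℝ) : ℂ) • auxJ i x := by
      rw [mem_auxEV.mp hx]; push_cast; rw [add_smul]
    by_cases h0 : s + w = 0
    · have := hG2 x
      rw [e, h0] at this
      simp only [Complex.ofReal_zero, zero_smul, map_zero] at this
      exact ⟨0, Submodule.zero_mem _, by simp [← this]⟩
    · have h0' : ((s + w : ℝ) : ℂ) ≠ 0 := by exact_mod_cast h0
      have hxS : x ∈ auxSum B i S := by
        have : auxEV B i s ≤ auxSum B i S := le_iSup₂_of_le s hs le_rfl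
        exact this hx
      refine ⟨((s + w : ℝ) : ℂ)⁻¹ • x, Submodule.smul_mem _ _ hxS, ?_⟩
      rw [map_smul, map_smul, smul_comm (w : ℂ), ← smul_add, e, smul_smul, inv_mul_cancel₀ h0',
        one_smul]
  · rintro x y ⟨x', hx', ex⟩ ⟨y', hy', ey⟩
    refine ⟨x' + y', Submodule.add_mem _ hx' hy', ?_⟩
    rw [map_add, map_add, map_add, smul_add, ← ex, ← ey]
    abel

theorem aux_equality {B : V →L[ℂ] V} {i : V →L[ℂ] H} {ω : ℝ} (h : auxCoer B i ω)
    (hB : ∀ u v, ⟪B v, u⟫ = ⟪v, B u⟫)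
    (hicpt : IsCompactOperator ⇑i) (t : ℝ) (S : Finset ℝ)
    (h2 : ∀ s : ℝ, s < t → auxEV B i s ≤ auxSum B i S)
    (u : V) (hu : ∀ w ∈ auxSum B i S, ⟪w, auxJ i u⟫ = 0)
    (heq : (⟪u, B u⟫).re ≤ t * ‖i u‖ ^ 2) :
    B u = (t : ℂ) • auxJ i u := by
  set D : V →L[ℂ] V := B - (t : ℂ) • auxJ i with hD
  have hDa : ∀ x, D x = B x - (t : ℂ) • auxJ i x := fun x => rfl
  have hDsymm : ∀ x y, ⟪D y, x⟫ = ⟪y, D x⟫ := by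
    intro x y
    rw [hDa, hDa, inner_sub_left, inner_sub_right, inner_smul_left, inner_smul_right, hB,
      auxJ_symm, Complex.conj_ofReal]
  have hDre : ∀ x, (⟪x, D x⟫).re = (⟪x, B x⟫).re - t * ‖i x‖ ^ 2 := by
    intro x
    rw [hDa, inner_sub_right, inner_smul_right, Complex.sub_re, Complex.re_ofReal_mul, auxJ_re]
  have hDpos : ∀ x, (∀ w ∈ auxSum B i S, ⟪w, auxJ i x⟫ = 0) → 0 ≤ (⟪x, D x⟫).re := by
    intro x hx
    have := auxSum_lower h hB hicpt t S h2 x hx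
    rw [hDre]; linarith
  have hDu : (⟪u, D u⟫).re = 0 := by
    refine le_antisymm ?_ (hDpos u hu)
    rw [hDre]; linarith
  -- orthogonal directions
  have hW : ∀ v, (∀ w ∈ auxSum B i S, ⟪w, auxJ i v⟫ = 0) → ⟪v, D u⟫ = 0 := by
    intro v hv
    set c := ⟪v, D u⟫ with hc
    set q := (⟪v, D v⟫).re with hq
    have hq0 : 0 ≤ q := hDpos v hv
    set ε : ℝ := 1 / (q + 1) with hε
    have hpos := hDpos (u - ((ε : ℂ) * c) • v) (by
      intro w hw
      rw [map_sub, map_smul, inner_sub_right, inner_smul_right, hu w hw, hv w hw]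
      simp)
    have huv : ⟪u, D v⟫ = conj c := by
      rw [← hDsymm, ← inner_conj_symm, hc]
    have hqq : ⟪v, D v⟫ = (q : ℂ) := by
      apply Complex.ext
      · simp [hq]
      · have : conj ⟪v, D v⟫ = ⟪v, D v⟫ := by rw [inner_conj_symm, hDsymm]
        simpa using Complex.conj_eq_iff_im.mp this
    have hexp : (⟪u - ((ε : ℂ) * c) • v, D (u - ((ε : ℂ) * c) • v)⟫).re
        = -2 * ε * ‖c‖ ^ 2 + ε ^ 2 * ‖c‖ ^ 2 * q := by
      rw [map_sub, map_smul, inner_sub_left, inner_sub_right, inner_sub_right, inner_smul_left,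
        inner_smul_left, inner_smul_right, inner_smul_right, huv, hqq, ← hc, map_mul,
        Complex.conj_ofReal]
      have e : ⟪u, D u⟫ - (ε : ℂ) * c * conj c
          - ((ε : ℂ) * conj c * c - (ε : ℂ) * conj c * ((ε : ℂ) * c * (q : ℂ)))
          = ⟪u, D u⟫ + ((-2 * ε * ‖c‖ ^ 2 + ε ^ 2 * ‖c‖ ^ 2 * q : ℝ) : ℂ) := by
        have hcc : c * conj c = ((‖c‖ ^ 2 : ℝ) : ℂ) := by
          rw [Complex.mul_conj, Complex.normSq_eq_norm_sq]
        push_cast at hcc ⊢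
        linear_combination (-2 * (ε : ℂ) + ε ^ 2 * q) * hcc
      rw [e, Complex.add_re, hDu, Complex.ofReal_re, zero_add]
    rw [hexp] at hpos
    have hεpos : 0 < ε := by positivity
    have hεq : ε * q ≤ 1 := by
      rw [hε, div_mul_eq_mul_div, one_mul, div_le_one (by positivity)]; linarith
    have : ε * ‖c‖ ^ 2 ≤ 0 := by
      have h3 : 0 ≤ ε * ‖c‖ ^ 2 := by positivity
      nlinarith
    have : ‖c‖ ^ 2 ≤ 0 := by
      by_contra! hcon
      have := mul_pos hεpos hcon
      linarith
    have : ‖c‖ = 0 := by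
      have := le_antisymm this (sq_nonneg _)
      exact pow_eq_zero_iff (two_ne_zero) |>.mp this
    exact norm_eq_zero.mp this
  have hF : ∀ v ∈ auxSum B i S, ⟪v, D u⟫ = 0 := by
    intro v hv
    have := auxSum_induction (p := fun v => ⟪v, D u⟫ = 0 ∧ ⟪v, auxJ i u⟫ = ⟪v, auxJ i u⟫) ?_
      (by simp) ?_ hv
    · exact this.1
    · intro s hs x hx
      refine ⟨?_, rfl⟩
      have hxS : x ∈ auxSum B i S := by
        have : auxEV B i s ≤ auxSum B i S := le_iSup₂_of_le s hs le_rfl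
        exact this hx
      rw [← hDsymm, hDa, mem_auxEV.mp hx, ← sub_smul, inner_smul_left, auxJ_symm, hu x hxS,
        mul_zero]
    · rintro x y ⟨hx, _⟩ ⟨hy, _⟩
      exact ⟨by rw [inner_add_left, hx, hy, add_zero], rfl⟩
  have hall : ∀ v, ⟪v, D u⟫ = 0 := by
    intro v
    have := auxSum_findim h hicpt S
    set F' : Submodule ℂ H := (auxSum B i S).map (i : V →ₗ[ℂ] H) with hF'
    have : FiniteDimensional ℂ F' := inferInstance
    obtain ⟨f, hf, hfv⟩ := Submodule.starProjection_apply_mem F' (i v)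
    have hfv' : i f = F'.starProjection (i v) := hfv
    have hort : ∀ w ∈ auxSum B i S, ⟪w, auxJ i (v - f)⟫ = 0 := by
      intro w hw
      rw [auxJ_inner, map_sub, hfv']
      exact (Submodule.mem_orthogonal _ _).mp
        (Submodule.sub_starProjection_mem_orthogonal (K := F') (i v)) _ ⟨w, hw, rfl⟩
    have e : v = (v - f) + f := by abel
    rw [e, inner_add_left, hW _ hort, hF f hf, add_zero]
  have : D u = 0 := inner_self_eq_zero.mp (hall (D u))
  rw [hDa] at this
  exact sub_eq_zero.mp this

theorem aux_finrank_eig (b : V → V → ℂ) (B : V →L[ℂ] V) (i : V →L[ℂ] H)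
    (hinj : Function.Injective ⇑i) (hb : ∀ u v, ⟪v, B u⟫ = b u v) (s : ℝ) :
    eigMult (GraphOfOn b i Set.univ) s = Module.finrank ℂ (auxEV B i s) := by
  have e : {x : H | (x, (s : ℂ) • x) ∈ GraphOfOn b i Set.univ}
      = ((auxEV B i s).map (i : V →ₗ[ℂ] H) : Set H) := by
    ext x
    constructor
    · rintro ⟨u, -, hxu, hv⟩
      dsimp only at hxu hv
      refine ⟨u, ?_, hxu.symm⟩
      change B u = _
      refine ext_inner_left ℂ fun v => ?_
      rw [hb, hv v trivial, inner_smul_right, inner_smul_right, auxJ_inner, hxu]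
    · rintro ⟨u, hu, rfl⟩
      refine ⟨u, trivial, rfl, fun v _ => ?_⟩
      have hu' : B u = (s : ℂ) • auxJ i u := hu
      rw [← hb, hu', inner_smul_right, auxJ_inner]
      change _ = ⟪i v, (s : ℂ) • i u⟫
      rw [inner_smul_right]
  rw [eigMult, e, Submodule.span_eq]
  exact (Submodule.equivMapOfInjective (i : V →ₗ[ℂ] H) hinj (auxEV B i s)).finrank_eq.symm

end Aux

/-- Lemma 2.6.
With `V`, `H`, `K` Hilbert spaces, `i : V → H` a compact injective embedding, `j : V → K`
compact, `a` a positive symmetric continuous `i`-elliptic form with `V_D = ker j`, and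
assuming that the self-adjoint operator `A^N` associated with `a` has no eigenvector in
`V_D`:  if for every `μ ∈ ℝ` the sequence `lam μ` enumerates the eigenvalues of the
self-adjoint graph `A_μ` associated with `(a_μ, i)` (where
`a_μ(u,v) = a(u,v) - μ (j u, j v)_K`) in increasing order repeated with multiplicity, then
for every `n` the function `μ ↦ lam μ n` is strictly decreasing on `ℝ`. -/
theorem statement5
    {V H K : Type*}
    [NormedAddCommGroup V] [InnerProductSpace ℂ V] [CompleteSpace V]
    [NormedAddCommGroup H] [InnerProductSpace ℂ H] [CompleteSpace H]
    [NormedAddCommGroup K] [InnerProductSpace ℂ K] [CompleteSpace K]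
    (i : V →L[ℂ] H) (hinj : Function.Injective ⇑i) (hicpt : IsCompactOperator ⇑i)
    (j : V →L[ℂ] K) (hjcpt : IsCompactOperator ⇑j)
    (a : V → V → ℂ)
    (hsesq : IsSesqui a) (hpos : IsPositiveForm a) (hsymm : IsSymmForm a)
    (hcont : IsContinuousForm a) (hell : IsElliptic a ⇑i)
    (hI : ∀ (u : V) (t : ℂ), j u = 0 → (i u, t • i u) ∈ OpGraphOf a i Set.univ → u = 0)
    (lam : ℝ → ℕ → ℝ)
    (hlam : ∀ μ : ℝ, IsEigSeq
      (GraphOfOn (fun u v => a u v - (μ : ℂ) * @inner ℂ _ _ (j v) (j u)) i Set.univ) (lam μ)) :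
    ∀ n : ℕ, StrictAnti (fun μ : ℝ => lam μ n) := by
  classical
  intro n μ₁ μ₂ hμ
  change lam μ₂ n < lam μ₁ n
  by_contra! hcon
  set t := lam μ₁ n with ht
  obtain ⟨A, hA⟩ := aux_form_rep a hsesq hsymm hcont
  -- the operators representing the forms
  let B : ℝ → V →L[ℂ] V := fun μ => A - (μ : ℂ) • auxJ j
  have hBa : ∀ μ u, B μ u = A u - (μ : ℂ) • auxJ j u := fun μ u => rfl
  have hBrep : ∀ μ u v, ⟪v, B μ u⟫ = a u v - (μ : ℂ) * ⟪j v, j u⟫ := by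
    intro μ u v
    rw [hBa, inner_sub_right, inner_smul_right, hA, auxJ_inner]
  have hAsymm : ∀ u v, ⟪A v, u⟫ = ⟪v, A u⟫ := by
    intro u v
    rw [← inner_conj_symm, hA, hA, hsymm v u]
  have hBsymm : ∀ μ u v, ⟪B μ v, u⟫ = ⟪v, B μ u⟫ := by
    intro μ u v
    rw [hBa, hBa, inner_sub_left, inner_sub_right, inner_smul_left, inner_smul_right, hAsymm,
      auxJ_symm, Complex.conj_ofReal]
  have hBre : ∀ μ u, (⟪u, B μ u⟫).re = (a u u).re - μ * ‖j u‖ ^ 2 := by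
    intro μ u
    rw [hBa, inner_sub_right, inner_smul_right, hA, Complex.sub_re, Complex.re_ofReal_mul,
      auxJ_re]
  have hcoer : ∀ μ, ∃ ω, auxCoer (B μ) i ω := by
    intro μ
    obtain ⟨ω, m, hω, hm, hel⟩ := hell
    obtain ⟨C, hC, hCu⟩ := aux_ehrling i hinj j hjcpt (m / (2 * (|μ| + 1))) (by positivity)
    refine ⟨ω + |μ| * C, m / 2, by positivity, fun u => ?_⟩
    have h1 := hel u
    have h2 := mul_le_mul_of_nonneg_left (hCu u) (abs_nonneg μ)
    have h3 : μ * ‖j u‖ ^ 2 ≤ |μ| * ‖j u‖ ^ 2 :=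
      mul_le_mul_of_nonneg_right (le_abs_self μ) (sq_nonneg _)
    have h4 : |μ| * (m / (2 * (|μ| + 1))) ≤ m / 2 := by
      rw [← mul_div_assoc, div_le_div_iff₀ (by positivity) (by positivity)]
      nlinarith [abs_nonneg μ]
    have h5 := mul_le_mul_of_nonneg_right h4 (sq_nonneg ‖u‖)
    rw [hBre]
    nlinarith
  have hmult : ∀ μ s, Nat.card {k : ℕ | lam μ k = s} = Module.finrank ℂ (auxEV (B μ) i s) := by
    intro μ s
    rw [(hlam μ).2.2 s]
    exact aux_finrank_eig _ (B μ) i hinj (hBrep μ) s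
  obtain ⟨ω₁, hc₁⟩ := hcoer μ₁
  obtain ⟨ω₂, hc₂⟩ := hcoer μ₂
  -- first family of eigenvalues
  let S₁ : Finset ℝ := (Finset.range (n + 1)).image (lam μ₁)
  let S₂ : Finset ℝ := ((Finset.range n).image (lam μ₂)).filter (· < t)
  have hr₁ : n + 1 ≤ Module.finrank ℂ (auxSum (B μ₁) i S₁) := by
    rw [auxSum_finrank hc₁ hinj (hBsymm μ₁) hicpt]
    calc n + 1 = (Finset.range (n + 1)).card := by simp
      _ = ∑ s ∈ S₁, ((Finset.range (n + 1)).filter (fun k => lam μ₁ k = s)).card :=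
        Finset.card_eq_sum_card_image _ _
      _ ≤ ∑ s ∈ S₁, Module.finrank ℂ (auxEV (B μ₁) i s) := by
        refine Finset.sum_le_sum fun s _ => ?_
        rw [← hmult, Nat.card_coe_set_eq, ← Set.ncard_coe_finset]
        refine Set.ncard_le_ncard ?_ ((hlam μ₁).2.1 s)
        intro k hk
        simp only [Finset.coe_filter] at hk
        exact hk.2
  have hlt : ∀ k, lam μ₂ k < t → k < n := by
    intro k hk
    by_contra! hnk
    have := (hlam μ₂).1 hnk
    linarith
  have hr₂ : Module.finrank ℂ (auxSum (B μ₂) i S₂) ≤ n := by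
    rw [auxSum_finrank hc₂ hinj (hBsymm μ₂) hicpt]
    calc ∑ s ∈ S₂, Module.finrank ℂ (auxEV (B μ₂) i s)
        ≤ ∑ s ∈ S₂, ((Finset.range n).filter (fun k => lam μ₂ k = s)).card := by
          refine Finset.sum_le_sum fun s hs => ?_
          have hst : s < t := (Finset.mem_filter.mp hs).2
          rw [← hmult, Nat.card_coe_set_eq, ← Set.ncard_coe_finset]
          refine Set.ncard_le_ncard ?_ (Finset.finite_toSet _)
          intro k hk
          have hk' : lam μ₂ k = s := hk
          rw [Finset.mem_coe, Finset.mem_filter, Finset.mem_range]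
          exact ⟨hlt k (by rw [hk']; exact hst), hk'⟩
      _ ≤ ∑ s ∈ (Finset.range n).image (lam μ₂),
            ((Finset.range n).filter (fun k => lam μ₂ k = s)).card :=
          Finset.sum_le_sum_of_subset (Finset.filter_subset _ _)
      _ = (Finset.range n).card := (Finset.card_eq_sum_card_image _ _).symm
      _ = n := by simp
  have h2 : ∀ s : ℝ, s < t → auxEV (B μ₂) i s ≤ auxSum (B μ₂) i S₂ := by
    intro s hs
    by_cases hk : ∃ k, lam μ₂ k = s
    · obtain ⟨k, hk⟩ := hk
      have hsS : s ∈ S₂ := by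
        rw [Finset.mem_filter, Finset.mem_image]
        exact ⟨⟨k, Finset.mem_range.mpr (hlt k (hk ▸ hs)), hk⟩, hs⟩
      exact le_iSup₂_of_le (f := fun s (_ : s ∈ S₂) => auxEV (B μ₂) i s) s hsS le_rfl
    · have h0 := hmult μ₂ s
      have hemp : {k : ℕ | lam μ₂ k = s} = ∅ := by
        ext k
        constructor
        · intro h; exact (hk ⟨k, h⟩).elim
        · intro h; exact h.elim
      rw [hemp, Nat.card_coe_set_eq, Set.ncard_empty] at h0
      have := aux_findim hc₂ hicpt s
      rw [Submodule.finrank_eq_zero.mp h0.symm]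
      exact bot_le
  -- a nonzero vector in the first space, orthogonal to the second
  obtain ⟨u, huE, hu0, huo⟩ : ∃ u ∈ auxSum (B μ₁) i S₁, u ≠ 0 ∧
      ∀ w ∈ auxSum (B μ₂) i S₂, ⟪w, auxJ i u⟫ = 0 := by
    have := auxSum_findim hc₁ hicpt S₁
    have := auxSum_findim hc₂ hicpt S₂
    set F₂ := auxSum (B μ₂) i S₂ with hF₂
    let φ : auxSum (B μ₁) i S₁ →ₗ[ℂ] F₂ :=
      ((F₂.orthogonalProjection ∘L auxJ i : V →L[ℂ] F₂) : V →ₗ[ℂ] F₂) ∘ₗ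
        (auxSum (B μ₁) i S₁).subtype
    have hker : LinearMap.ker φ ≠ ⊥ := LinearMap.ker_ne_bot_of_finrank_lt (by omega)
    obtain ⟨x, hx, hx0⟩ := Submodule.exists_mem_ne_zero_of_ne_bot hker
    refine ⟨x, x.2, fun h => hx0 (Subtype.ext h), fun w hw => ?_⟩
    have hx' : F₂.orthogonalProjection (auxJ i (x : V)) = 0 := hx
    exact (Submodule.mem_orthogonal _ _).mp
      (Submodule.orthogonalProjection_eq_zero_iff.mp hx') w hw
  have hup := auxSum_upper (hBsymm μ₁) S₁ t (by
    intro s hs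
    obtain ⟨k, hk, rfl⟩ := Finset.mem_image.mp hs
    exact (hlam μ₁).1 (Nat.lt_succ_iff.mp (Finset.mem_range.mp hk))) huE
  have hlow := auxSum_lower hc₂ (hBsymm μ₂) hicpt t S₂ h2 u huo
  rw [hBre] at hup hlow
  have hju : ‖j u‖ ^ 2 = 0 := by
    have h3 : (μ₂ - μ₁) * ‖j u‖ ^ 2 ≤ 0 := by linarith
    have h4 : 0 < μ₂ - μ₁ := by linarith
    refine le_antisymm ?_ (sq_nonneg _)
    by_contra! h5
    have := mul_pos h4 h5
    linarith
  have hju0 : j u = 0 := by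
    have := pow_eq_zero_iff (two_ne_zero) |>.mp hju
    exact norm_eq_zero.mp this
  have heq := aux_equality hc₂ (hBsymm μ₂) hicpt t S₂ h2 u huo (by
    rw [hBre, hju]; rw [hju] at hup; linarith)
  refine hu0 (hI u t hju0 ⟨u, trivial, rfl, ?_, fun v _ => ?_⟩)
  · refine subset_closure ⟨(t : ℂ) • u, trivial, ?_⟩
    rw [map_smul]
  · have := hBrep μ₂ u v
    rw [hju0, inner_zero_right, mul_zero, sub_zero, heq, inner_smul_right, auxJ_inner] at this
    change _ = ⟪i v, (t : ℂ) • i u⟫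
    rw [← this, inner_smul_right]
end
end
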